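/- arXiv:2305.10202 — 2 statements merged into one kernel-verified Lean document; each statement's English description precedes it below -/
import Mathlib

section
/- Let R be a commutative Noetherian ring with Krull dimension dim R ≤ 2 and let 𝔞 be an ideal of R. Then for any R-module M, the local cohomology module H^i_𝔞(M) is 𝔞-cofinite for all i ≥ 0 if and only if Ext^i_R(R/𝔞, M) is a finitely generated R-module for all i ≥ 0. -/
universe u

open CategoryTheory

/-- The `i`-th Ext module `Ext^i_R(N, M)`. -/
noncomputable def extModule (R : Type u) [CommRing R] (N M : Type u)
    [AddCommGroup N] [Module R N] [AddCommGroup M] [Module R M] (i : ℕ) :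
    ModuleCat.{u} R :=
  ((Ext R (ModuleCat.{u} R) i).obj (Opposite.op (ModuleCat.of R N))).obj (ModuleCat.of R M)

/-- The `i`-th local cohomology module `H^i_𝔞(M)`. -/
noncomputable def localCohomologyModule (R : Type u) [CommRing R] (𝔞 : Ideal R)
    (M : Type u) [AddCommGroup M] [Module R M] (i : ℕ) : ModuleCat.{u} R :=
  (localCohomology 𝔞 i).obj (ModuleCat.of R M)

/-- An `R`-module `M` is `𝔞`-cofinite if `Supp M ⊆ V(𝔞)` and all the modules
`Ext^i_R(R/𝔞, M)` are finitely generated. -/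
def IsCofinite (R : Type u) [CommRing R] (𝔞 : Ideal R)
    (M : Type u) [AddCommGroup M] [Module R M] : Prop :=
  Module.support R M ⊆ PrimeSpectrum.zeroLocus (𝔞 : Set R) ∧
    ∀ i : ℕ, Module.Finite R (extModule R (R ⧸ 𝔞) M i)

/-- An `R`-module `M` is `FD_{<n}` if it has a finitely generated submodule `N` such that
the (Krull) dimension of the support of `M/N` is `< n`. -/
def IsFDLT (R : Type u) [CommRing R] (n : ℕ)
    (M : Type u) [AddCommGroup M] [Module R M] : Prop :=
  ∃ N : Submodule R M, N.FG ∧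
    Order.krullDim (Module.support R (M ⧸ N)) < ((n : ℕ∞) : WithBot ℕ∞)

section Comparison

open Abelian

variable {R : Type u} [CommRing R]

lemma extMk_smul {X Y : ModuleCat.{u} R} (P : ProjectiveResolution X) {n : ℕ} (r : R)
    (f : P.complex.X n ⟶ Y) (m : ℕ) (hm : n + 1 = m) (hf : P.complex.d m n ≫ f = 0) :
    P.extMk (r • f) m hm (by simp [hf]) = r • P.extMk f m hm hf := by
  rw [Ext.smul_eq_comp_mk₀, P.extMk_comp_mk₀]
  simp

variable (n : ℕ) (Y : ModuleCat.{u} R)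

/-- The complex `Hom(P, Y)`, viewed as a chain complex in the opposite category of modules. -/
noncomputable abbrev homComplex {X : ModuleCat.{u} R} (P : ProjectiveResolution X) :
    ChainComplex (ModuleCat.{u} R)ᵒᵖ ℕ :=
  ((((linearYoneda R (ModuleCat.{u} R)).obj Y).rightOp).mapHomologicalComplex _).obj P.complex

/-- The module of `n`-cocycles of `Hom(P, Y)`. -/
noncomputable abbrev homCocycles {X : ModuleCat.{u} R} (P : ProjectiveResolution X) :
    ModuleCat.{u} R :=
  ((homComplex Y P).opcycles n).unop

/-- The inclusion of cocycles into cochains. -/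
noncomputable def homCocyclesι {X : ModuleCat.{u} R} (P : ProjectiveResolution X) :
    homCocycles n Y P →ₗ[R] (P.complex.X n ⟶ Y) :=
  ((homComplex Y P).pOpcycles n).unop.hom

lemma homCocyclesι_injective {X : ModuleCat.{u} R} (P : ProjectiveResolution X) :
    Function.Injective (homCocyclesι n Y P) := by
  have : Mono ((homComplex Y P).pOpcycles n).unop := inferInstance
  exact (ModuleCat.mono_iff_injective _).1 this

lemma d_comp_homCocyclesι {X : ModuleCat.{u} R} (P : ProjectiveResolution X) (m : ℕ)
    (a : homCocycles n Y P) : P.complex.d m n ≫ homCocyclesι n Y P a = 0 := by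
  have h := congrArg Quiver.Hom.unop ((homComplex Y P).d_pOpcycles m n)
  exact ConcreteCategory.congr_hom h a

lemma exists_homCocyclesι_eq {X : ModuleCat.{u} R} (P : ProjectiveResolution X)
    (f : P.complex.X n ⟶ Y) (hf : P.complex.d (n + 1) n ≫ f = 0) :
    ∃ a, homCocyclesι n Y P a = f := by
  let k : (homComplex Y P).X n ⟶ Opposite.op (ModuleCat.of R R) :=
    (ModuleCat.ofHom (LinearMap.toSpanSingleton R (P.complex.X n ⟶ Y) f)).op
  have hk : (homComplex Y P).d (n + 1) n ≫ k = 0 := by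
    apply Quiver.Hom.unop_inj
    ext
    change P.complex.d (n + 1) n ≫ ((1 : R) • f) = 0
    simp [hf]
  let g := (homComplex Y P).descOpcycles k (n + 1) (by simp) hk
  refine ⟨g.unop.hom (1 : R), ?_⟩
  have h := congrArg Quiver.Hom.unop ((homComplex Y P).p_descOpcycles k (n + 1) (by simp) hk)
  have := ConcreteCategory.congr_hom h (1 : R)
  refine this.trans ?_
  change (1 : R) • f = f
  simp

/-- The projection from cocycles to cohomology. -/
noncomputable def homCocyclesπ {X : ModuleCat.{u} R} (P : ProjectiveResolution X) :
    homCocycles n Y P →ₗ[R] ((homComplex Y P).homology n).unop :=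
  ((homComplex Y P).homologyι n).unop.hom

lemma homCocyclesπ_surjective {X : ModuleCat.{u} R} (P : ProjectiveResolution X) :
    Function.Surjective (homCocyclesπ n Y P) := by
  have : Epi ((homComplex Y P).homologyι n).unop := inferInstance
  exact (ModuleCat.epi_iff_surjective _).1 this

lemma homCocyclesπ_eq_zero_iff {X : ModuleCat.{u} R} (P : ProjectiveResolution X)
    (a : homCocycles n Y P) :
    homCocyclesπ n Y P a = 0 ↔
      ∃ g, P.complex.d n ((ComplexShape.down ℕ).next n) ≫ g = homCocyclesι n Y P a := by
  let S : ShortComplex (ModuleCat.{u} R)ᵒᵖ := ShortComplex.mk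
    ((homComplex Y P).homologyι n) ((homComplex Y P).fromOpcycles n _)
    ((homComplex Y P).homologyι_comp_fromOpcycles n ((ComplexShape.down ℕ).next n))
  have hS : S.Exact := S.exact_of_f_is_kernel ((homComplex Y P).homologyIsKernel n _ rfl)
  have hS' := (ShortComplex.ShortExact.moduleCat_exact_iff_function_exact _).1 hS.unop
  have hd := congrArg Quiver.Hom.unop
    ((homComplex Y P).p_fromOpcycles n ((ComplexShape.down ℕ).next n))
  refine (hS' a).trans ⟨?_, ?_⟩
  · rintro ⟨g, rfl⟩
    exact ⟨g, (ConcreteCategory.congr_hom hd g).symm⟩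
  · rintro ⟨g, hg⟩
    refine ⟨g, homCocyclesι_injective n Y P ?_⟩
    exact (ConcreteCategory.congr_hom hd g).trans hg

/-- The class in `Ext` of a cocycle. -/
noncomputable def homCocyclesToExt {X : ModuleCat.{u} R} (P : ProjectiveResolution X) :
    homCocycles n Y P →ₗ[R] Ext X Y n where
  toFun a := P.extMk (homCocyclesι n Y P a) (n + 1) rfl (d_comp_homCocyclesι n Y P _ a)
  map_add' a b := by
    rw [P.add_extMk]
    congr 1
    exact map_add _ _ _
  map_smul' r a := by
    rw [RingHom.id_apply, ← extMk_smul]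
    congr 1
    exact map_smul _ _ _

lemma homCocyclesToExt_surjective {X : ModuleCat.{u} R} (P : ProjectiveResolution X) :
    Function.Surjective (homCocyclesToExt n Y P) := by
  intro x
  obtain ⟨f, hf, rfl⟩ := P.extMk_surjective x (n + 1) rfl
  obtain ⟨a, rfl⟩ := exists_homCocyclesι_eq n Y P f hf
  exact ⟨a, rfl⟩

lemma extMk_eq_zero_iff_next {X : ModuleCat.{u} R} (P : ProjectiveResolution X)
    (f : P.complex.X n ⟶ Y) (hf : P.complex.d (n + 1) n ≫ f = 0) :
    P.extMk f (n + 1) rfl hf = 0 ↔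
      ∃ g, P.complex.d n ((ComplexShape.down ℕ).next n) ≫ g = f := by
  cases n with
  | succ n =>
    rw [P.extMk_eq_zero_iff f (n + 2) rfl hf n rfl]
    have : (ComplexShape.down ℕ).next (n + 1) = n := by simp
    rw [this]
  | zero =>
    have hd : P.complex.d 0 ((ComplexShape.down ℕ).next 0) = 0 :=
      P.complex.shape _ _ (by simp)
    simp only [hd, Limits.zero_comp, exists_const]
    refine ⟨fun h => ?_, fun h => by subst h; simp⟩
    rw [← P.extEquivCohomologyClass.apply_eq_iff_eq, P.extEquivCohomologyClass_extMk,
      P.extEquivCohomologyClass_zero, CochainComplex.HomComplex.CohomologyClass.mk_eq_zero_iff,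
      CochainComplex.HomComplex.Cocycle.toSingleMk_mem_coboundaries_iff _ _ _ _ _ 1 (by simp)] at h
    obtain ⟨g, hg⟩ := h
    have hz := CochainComplex.isZero_of_isStrictlyLE P.cochainComplex 0 1 (by lia)
    rw [hz.eq_of_src g 0, Limits.comp_zero] at hg
    rw [← cancel_epi (P.cochainComplexXIso (-(0 : ℕ)) 0 rfl).hom, ← hg, Limits.comp_zero]

lemma ker_homCocyclesπ {X : ModuleCat.{u} R} (P : ProjectiveResolution X) :
    LinearMap.ker (homCocyclesπ n Y P) = LinearMap.ker (homCocyclesToExt n Y P) := by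
  ext a
  rw [LinearMap.mem_ker, LinearMap.mem_ker, homCocyclesπ_eq_zero_iff]
  exact (extMk_eq_zero_iff_next n Y P _ (d_comp_homCocyclesι n Y P _ a)).symm

/-- Comparison of cohomology of `Hom(P, Y)` with `Ext`. -/
noncomputable def homologyEquivExt {X : ModuleCat.{u} R} (P : ProjectiveResolution X) :
    ((homComplex Y P).homology n).unop ≃ₗ[R] Ext X Y n :=
  ((homCocyclesπ n Y P).quotKerEquivOfSurjective (homCocyclesπ_surjective n Y P)).symm ≪≫ₗ
    Submodule.quotEquivOfEq _ _ (ker_homCocyclesπ n Y P) ≪≫ₗ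
    (homCocyclesToExt n Y P).quotKerEquivOfSurjective (homCocyclesToExt_surjective n Y P)

lemma homologyEquivExt_apply {X : ModuleCat.{u} R} (P : ProjectiveResolution X)
    (a : homCocycles n Y P) :
    homologyEquivExt n Y P (homCocyclesπ n Y P a) = homCocyclesToExt n Y P a := by
  have : ((homCocyclesπ n Y P).quotKerEquivOfSurjective (homCocyclesπ_surjective n Y P)).symm
      (homCocyclesπ n Y P a) = Submodule.Quotient.mk a := by
    rw [LinearEquiv.symm_apply_eq]; rfl
  simp only [homologyEquivExt, LinearEquiv.trans_apply, this]
  rfl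

lemma homologyEquivExt_naturality {X X' : ModuleCat.{u} R} {g : X' ⟶ X}
    {P' : ProjectiveResolution X'} {P : ProjectiveResolution X}
    (φ : ProjectiveResolution.Hom P' P g) (x : ((homComplex Y P).homology n).unop) :
    homologyEquivExt n Y P' ((HomologicalComplex.homologyMap
      (((((linearYoneda R (ModuleCat.{u} R)).obj Y).rightOp).mapHomologicalComplex _).map φ.hom)
        n).unop.hom x) =
      (Ext.mk₀ g).comp (homologyEquivExt n Y P x) (zero_add _) := by
  obtain ⟨a, rfl⟩ := homCocyclesπ_surjective n Y P x
  let ψ := (((linearYoneda R (ModuleCat.{u} R)).obj Y).rightOp.mapHomologicalComplex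
    (ComplexShape.down ℕ)).map φ.hom
  let b : homCocycles n Y P' := (HomologicalComplex.opcyclesMap ψ n).unop.hom a
  have hb : homCocyclesπ n Y P' b =
      (HomologicalComplex.homologyMap ψ n).unop.hom (homCocyclesπ n Y P a) :=
    (ConcreteCategory.congr_hom
      (congrArg Quiver.Hom.unop (HomologicalComplex.homologyι_naturality ψ n)) a).symm
  have hb' : homCocyclesι n Y P' b = φ.hom.f n ≫ homCocyclesι n Y P a :=
    ConcreteCategory.congr_hom
      (congrArg Quiver.Hom.unop (HomologicalComplex.p_opcyclesMap ψ n)) a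
  rw [← hb, homologyEquivExt_apply, homologyEquivExt_apply]
  refine Eq.trans ?_ (ProjectiveResolution.mk₀_comp_extMk _ _ rfl
    (d_comp_homCocyclesι n Y P _ a) φ).symm
  change P'.extMk (homCocyclesι n Y P' b) (n + 1) rfl (d_comp_homCocyclesι n Y P' _ b) = _
  simp only [hb']

/-- The comparison between the two constructions of `Ext` for modules. -/
noncomputable def extEquiv (X : ModuleCat.{u} R) :
    ((_root_.Ext R (ModuleCat.{u} R) n).obj (Opposite.op X)).obj Y ≃ₗ[R] Ext X Y n :=
  (((projectiveResolution X).isoLeftDerivedObj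
      ((linearYoneda R (ModuleCat.{u} R)).obj Y).rightOp n).unop.symm).toLinearEquiv ≪≫ₗ
    homologyEquivExt n Y (projectiveResolution X)

lemma extEquiv_naturality {X X' : ModuleCat.{u} R} (g : X' ⟶ X)
    (x : ((_root_.Ext R (ModuleCat.{u} R) n).obj (Opposite.op X)).obj Y) :
    extEquiv n Y X' ((((_root_.Ext R (ModuleCat.{u} R) n).map g.op).app Y).hom x) =
      (Ext.mk₀ g).comp (extEquiv n Y X x) (zero_add _) := by
  let φ : ProjectiveResolution.Hom (projectiveResolution X') (projectiveResolution X) g :=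
    { hom := ProjectiveResolution.lift g _ _
      hom_f_zero_comp_π_f_zero := ProjectiveResolution.lift_commutes_zero g _ _ }
  refine Eq.trans ?_ (homologyEquivExt_naturality n Y φ _)
  refine congrArg (homologyEquivExt n Y (projectiveResolution X')) ?_
  have h := congrArg Quiver.Hom.unop (ProjectiveResolution.isoLeftDerivedObj_inv_naturality g
    (projectiveResolution X') (projectiveResolution X) φ.hom
    (ProjectiveResolution.lift_commutes_zero g _ _)
    ((linearYoneda R (ModuleCat.{u} R)).obj Y).rightOp n)
  exact ConcreteCategory.congr_hom h x

end Comparison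

section ExtModules

variable {R : Type u} [CommRing R]

/-- The `i`-th Ext module, in terms of the derived category. -/
abbrev ExtM (R : Type u) [CommRing R] (N M : Type u) [AddCommGroup N] [Module R N]
    [AddCommGroup M] [Module R M] (i : ℕ) : Type u :=
  Abelian.Ext (ModuleCat.of R N) (ModuleCat.of R M) i

namespace ExtM

variable (N : Type u) [AddCommGroup N] [Module R N]
  {N' N'' : Type u} [AddCommGroup N'] [Module R N'] [AddCommGroup N''] [Module R N'']
  (M : Type u) [AddCommGroup M] [Module R M]
  {A B C : Type u} [AddCommGroup A] [Module R A] [AddCommGroup B] [Module R B]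
  [AddCommGroup C] [Module R C]

/-- Functoriality in the second variable. -/
noncomputable def post (i : ℕ) (f : A →ₗ[R] B) : ExtM R N A i →ₗ[R] ExtM R N B i :=
  (Abelian.Ext.mk₀ (ModuleCat.ofHom f)).postcompOfLinear R (ModuleCat.of R N) (add_zero i)

variable {N} in
/-- Functoriality in the first variable. -/
noncomputable def pre (i : ℕ) (g : N' →ₗ[R] N) : ExtM R N M i →ₗ[R] ExtM R N' M i :=
  (Abelian.Ext.mk₀ (ModuleCat.ofHom g)).precompOfLinear R (ModuleCat.of R M) (zero_add i)

lemma post_apply (i : ℕ) (f : A →ₗ[R] B) (x : ExtM R N A i) :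
    post N i f x = x.comp (Abelian.Ext.mk₀ (ModuleCat.ofHom f)) (add_zero i) := rfl

lemma pre_apply (i : ℕ) (g : N' →ₗ[R] N) (x : ExtM R N M i) :
    pre M i g x = (Abelian.Ext.mk₀ (ModuleCat.ofHom g)).comp x (zero_add i) := rfl

lemma post_id (i : ℕ) : post N i (LinearMap.id : A →ₗ[R] A) = LinearMap.id := by
  ext x
  exact x.comp_mk₀_id

lemma post_comp (i : ℕ) (g : B →ₗ[R] C) (f : A →ₗ[R] B) :
    post N i (g ∘ₗ f) = post N i g ∘ₗ post N i f := by
  ext x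
  simp [post_apply]

lemma post_add (i : ℕ) (f g : A →ₗ[R] B) : post N i (f + g) = post N i f + post N i g := by
  ext x
  simp [post_apply, ModuleCat.ofHom_add, Abelian.Ext.mk₀_add, Abelian.Ext.comp_add]

lemma post_smul (i : ℕ) (r : R) (f : A →ₗ[R] B) : post N i (r • f) = r • post N i f := by
  ext x
  have : ModuleCat.ofHom (r • f) = r • ModuleCat.ofHom f := rfl
  simp [post_apply, this, Abelian.Ext.mk₀_smul]

lemma post_zero (i : ℕ) : post N i (0 : A →ₗ[R] B) = 0 := by
  simpa using post_smul N i (0 : R) (0 : A →ₗ[R] B)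

lemma post_smul_id (i : ℕ) (r : R) :
    post N i (r • LinearMap.id : A →ₗ[R] A) = r • LinearMap.id := by
  rw [post_smul, post_id]

lemma pre_id (i : ℕ) : pre M i (LinearMap.id : N →ₗ[R] N) = LinearMap.id := by
  ext x
  exact x.mk₀_id_comp

variable {N} in
lemma pre_comp (i : ℕ) (g : N' →ₗ[R] N) (f : N'' →ₗ[R] N') :
    pre M i (g ∘ₗ f) = pre M i f ∘ₗ pre M i g := by
  ext x
  simp [pre_apply]

variable {N} in
lemma pre_smul (i : ℕ) (r : R) (f : N' →ₗ[R] N) : pre M i (r • f) = r • pre M i f := by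
  ext x
  have : ModuleCat.ofHom (r • f) = r • ModuleCat.ofHom f := rfl
  simp [pre_apply, this, Abelian.Ext.mk₀_smul]

lemma pre_post (i : ℕ) (g : N' →ₗ[R] N) (f : A →ₗ[R] B) (x : ExtM R N A i) :
    pre B i g (post N i f x) = post N' i f (pre A i g x) := by
  simp only [pre_apply, post_apply]
  exact (Abelian.Ext.comp_assoc _ _ _ _ _ (by simp)).symm

lemma smul_eq_zero_of_left (i : ℕ) (r : R) (h : ∀ y : N, r • y = 0) (x : ExtM R N M i) :
    r • x = 0 := by
  have h0 : (r • LinearMap.id : N →ₗ[R] N) = (0 : R) • LinearMap.id := by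
    ext y; simp [h]
  have := congrArg (fun f => pre M i f x) h0
  rw [zero_smul, pre_smul, pre_id, ← zero_smul R (LinearMap.id : N →ₗ[R] N),
    pre_smul, zero_smul] at this
  exact this

lemma smul_eq_zero_of_right (i : ℕ) (r : R) (h : ∀ y : M, r • y = 0) (x : ExtM R N M i) :
    r • x = 0 := by
  have h0 : (r • LinearMap.id : M →ₗ[R] M) = (0 : R) • LinearMap.id := by
    ext y; simp [h]
  have := congrArg (fun f => post N i f x) h0
  rw [zero_smul, post_smul, post_id, post_zero] at this
  exact this

/-- An isomorphism in the second variable induces an isomorphism on Ext. -/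
noncomputable def congrRight (i : ℕ) (e : A ≃ₗ[R] B) : ExtM R N A i ≃ₗ[R] ExtM R N B i :=
  LinearEquiv.ofLinearMap (post N i e.toLinearMap) (post N i e.symm.toLinearMap)
    (by rw [← post_comp, LinearEquiv.comp_symm, post_id])
    (by rw [← post_comp, LinearEquiv.symm_comp, post_id])

section Exact

variable {f : A →ₗ[R] B} {g : B →ₗ[R] C}

/-- The short exact sequence in the category of modules. -/
lemma shortExact (hf : Function.Injective f) (hfg : Function.Exact f g)
    (hg : Function.Surjective g) :
    (ShortComplex.mk (ModuleCat.ofHom f) (ModuleCat.ofHom g)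
    (by ext x; exact hfg.apply_apply_eq_zero x)).ShortExact :=
  ModuleCat.shortComplex_shortExact _ hfg hf hg

variable (hf : Function.Injective f) (hfg : Function.Exact f g) (hg : Function.Surjective g)

/-- The connecting homomorphism. -/
noncomputable def delta (i : ℕ) : ExtM R N C i →ₗ[R] ExtM R N A (i + 1) :=
  (shortExact hf hfg hg).extClass.postcompOfLinear R (ModuleCat.of R N) rfl

lemma exact_post_post (hf : Function.Injective f) (hfg : Function.Exact f g)
    (hg : Function.Surjective g) (i : ℕ) : Function.Exact (post N i f) (post N i g) := by
  intro x
  refine ⟨Abelian.Ext.covariant_sequence_exact₂ _ (shortExact hf hfg hg) x, ?_⟩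
  rintro ⟨y, rfl⟩
  rw [← LinearMap.comp_apply, ← post_comp, hfg.linearMap_comp_eq_zero, post_zero]
  rfl

lemma exact_post_delta (i : ℕ) : Function.Exact (post N i g) (delta N hf hfg hg i) := by
  intro x
  refine ⟨Abelian.Ext.covariant_sequence_exact₃ _ (shortExact hf hfg hg) x rfl, ?_⟩
  rintro ⟨y, rfl⟩
  refine (Abelian.Ext.comp_assoc y (Abelian.Ext.mk₀ (ModuleCat.ofHom g))
    (shortExact hf hfg hg).extClass (add_zero i) (zero_add 1) (by simp)).trans ?_
  rw [(shortExact hf hfg hg).comp_extClass, Abelian.Ext.comp_zero]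

lemma exact_delta_post (i : ℕ) :
    Function.Exact (delta N hf hfg hg i) (post N (i + 1) f) := by
  intro x
  refine ⟨fun h => Abelian.Ext.covariant_sequence_exact₁ _ (shortExact hf hfg hg) x h rfl, ?_⟩
  rintro ⟨y, rfl⟩
  refine (Abelian.Ext.comp_assoc y (shortExact hf hfg hg).extClass
    (Abelian.Ext.mk₀ (ModuleCat.ofHom f)) rfl (add_zero 1) (by simp)).trans ?_
  rw [(shortExact hf hfg hg).extClass_comp, Abelian.Ext.comp_zero]

lemma post_zero_injective (hf : Function.Injective f) : Function.Injective (post N 0 f) := by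
  have : Mono (ModuleCat.ofHom f) := (ModuleCat.mono_iff_injective _).2 hf
  exact Abelian.Ext.postcomp_mk₀_injective_of_mono _ _

lemma pre_delta (i : ℕ) (k : N' →ₗ[R] N) (x : ExtM R N C i) :
    pre A (i + 1) k (delta N hf hfg hg i x) = delta N' hf hfg hg i (pre C i k x) :=
  (Abelian.Ext.comp_assoc (Abelian.Ext.mk₀ (ModuleCat.ofHom k)) x
    (shortExact hf hfg hg).extClass (zero_add i) rfl (by simp)).symm

end Exact

end ExtM

end ExtModules

section FiniteExt

variable {R : Type u} [CommRing R] (a : Ideal R)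

/-- Finiteness of `Ext^i(R/a, M)`. -/
def ExtFin (M : Type u) [AddCommGroup M] [Module R M] (i : ℕ) : Prop :=
  Module.Finite R (ExtM R (R ⧸ a) M i)

variable {M : Type u} [AddCommGroup M] [Module R M]
  {A B C : Type u} [AddCommGroup A] [Module R A] [AddCommGroup B] [Module R B]
  [AddCommGroup C] [Module R C] {f : A →ₗ[R] B} {g : B →ₗ[R] C}

variable {a} in
lemma ExtFin.congr {i : ℕ} (e : A ≃ₗ[R] B) (h : ExtFin a A i) : ExtFin a B i :=
  have : Module.Finite R (ExtM R (R ⧸ a) A i) := h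
  Module.Finite.equiv (ExtM.congrRight (R ⧸ a) i e)

lemma extFin_of_subsingleton [Subsingleton M] (i : ℕ) : ExtFin a M i := by
  have : Subsingleton (ExtM R (R ⧸ a) M i) := by
    refine ⟨fun x y => ?_⟩
    rw [← one_smul R x, ← one_smul R y,
      ExtM.smul_eq_zero_of_right _ _ _ _ (fun y => Subsingleton.elim _ _),
      ExtM.smul_eq_zero_of_right _ _ _ _ (fun y => Subsingleton.elim _ _)]
  change Module.Finite R _
  infer_instance

lemma mem_torsionBySet_ideal {b : Ideal R} {x : M} :
    x ∈ Submodule.torsionBySet R M (b : Set R) ↔ ∀ r ∈ b, r • x = 0 := by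
  simp [Submodule.mem_torsionBySet_iff]

/-- `Ext^0(R/a, M)` is the `a`-torsion of `M`. -/
noncomputable def extZeroEquiv : ExtM R (R ⧸ a) M 0 ≃ₗ[R] Submodule.torsionBySet R M (a : Set R) :=
  Abelian.Ext.linearEquiv₀ ≪≫ₗ ModuleCat.homLinearEquiv (S := R) ≪≫ₗ
    LinearEquiv.ofBijective
      (LinearMap.codRestrict _ (LinearMap.applyₗ (1 : R ⧸ a)) fun f => by
        rw [mem_torsionBySet_ideal]
        intro r hr
        change r • f 1 = 0
        rw [← map_smul, Algebra.smul_def, mul_one, Ideal.Quotient.algebraMap_eq,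
          Ideal.Quotient.eq_zero_iff_mem.2 hr, map_zero])
      ⟨fun f g h => by
        have h1 : f 1 = g 1 := congrArg Subtype.val h
        ext
        exact h1, fun x => by
        refine ⟨Submodule.liftQ a (LinearMap.toSpanSingleton R M x) ?_, ?_⟩
        · intro r hr
          exact mem_torsionBySet_ideal.1 x.2 r hr
        · ext
          exact one_smul R _⟩

lemma extFin_zero_iff :
    ExtFin a M 0 ↔ Module.Finite R (Submodule.torsionBySet R M (a : Set R)) :=
  Module.Finite.equiv_iff (extZeroEquiv a)

variable [IsNoetherianRing R]

lemma Module.Finite.of_function_exact {X Y Z : Type*} [AddCommGroup X] [Module R X] [AddCommGroup Y]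
    [Module R Y] [AddCommGroup Z] [Module R Z] (f : X →ₗ[R] Y) (g : Y →ₗ[R] Z)
    (h : Function.Exact f g) (hX : Module.Finite R X) (hZ : Module.Finite R Z) :
    Module.Finite R Y := by
  have := isNoetherian_of_range_eq_ker f g (LinearMap.exact_iff.1 h).symm
  infer_instance

lemma extFin_of_finite [Module.Finite R M] (i : ℕ) : ExtFin a M i :=
  ModuleCat.finite_ext R _ _ i

section Exact

variable (hf : Function.Injective f) (hfg : Function.Exact f g) (hg : Function.Surjective g)

variable {a} {i : ℕ}

lemma ExtFin.mid (hf : Function.Injective f) (hfg : Function.Exact f g)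
    (hg : Function.Surjective g) (hA : ExtFin a A i) (hC : ExtFin a C i) : ExtFin a B i :=
  Module.Finite.of_function_exact _ _ (ExtM.exact_post_post (R ⧸ a) hf hfg hg i) hA hC

lemma ExtFin.left (hf : Function.Injective f) (hfg : Function.Exact f g)
    (hg : Function.Surjective g) (hC : ExtFin a C i) (hB : ExtFin a B (i + 1)) :
    ExtFin a A (i + 1) :=
  Module.Finite.of_function_exact _ _ (ExtM.exact_delta_post (R ⧸ a) hf hfg hg i) hC hB

lemma ExtFin.right (hf : Function.Injective f) (hfg : Function.Exact f g)
    (hg : Function.Surjective g) (hB : ExtFin a B i) (hA : ExtFin a A (i + 1)) :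
    ExtFin a C i :=
  Module.Finite.of_function_exact _ _ (ExtM.exact_post_delta (R ⧸ a) hf hfg hg i) hB hA

lemma ExtFin.of_injective (hf : Function.Injective f) (hB : ExtFin a B 0) : ExtFin a A 0 :=
  have : Module.Finite R (ExtM R (R ⧸ a) B 0) := hB
  Module.Finite.of_injective _ (ExtM.post_zero_injective (R ⧸ a) hf)

end Exact

variable {a} in
lemma ExtFin.torsion_pow (h : ExtFin a M 0) (k : ℕ) :
    Module.Finite R (Submodule.torsionBySet R M (a ^ k : Ideal R)) := by
  rw [extFin_zero_iff] at h
  induction k with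
  | zero =>
    have : Subsingleton (Submodule.torsionBySet R M ((a ^ 0 : Ideal R) : Set R)) := by
      refine ⟨fun x y => Subtype.ext ?_⟩
      have hx := mem_torsionBySet_ideal.1 x.2 1 (by simp)
      have hy := mem_torsionBySet_ideal.1 y.2 1 (by simp)
      rw [one_smul] at hx hy
      rw [hx, hy]
    infer_instance
  | succ k ih =>
    obtain ⟨s, hs⟩ := (isNoetherianRing_iff_ideal_fg R).1 inferInstance a
    let φ : Submodule.torsionBySet R M ((a ^ (k + 1) : Ideal R) : Set R) →ₗ[R]
        (s → Submodule.torsionBySet R M ((a ^ k : Ideal R) : Set R)) :=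
      LinearMap.pi fun x => LinearMap.codRestrict _
        ((x : R) • (Submodule.subtype _)) fun y => by
          rw [mem_torsionBySet_ideal]
          intro r hr
          change r • (x : R) • (y : M) = 0
          rw [smul_smul]
          exact mem_torsionBySet_ideal.1 y.2 _ (by
            rw [pow_succ]
            exact Ideal.mul_mem_mul hr (hs ▸ Submodule.subset_span x.2))
    let ψ : Submodule.torsionBySet R M (a : Set R) →ₗ[R]
        Submodule.torsionBySet R M ((a ^ (k + 1) : Ideal R) : Set R) :=
      Submodule.inclusion fun y hy => by
        rw [mem_torsionBySet_ideal] at hy ⊢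
        exact fun r hr => hy r (Ideal.pow_le_self (by simp) hr)
    refine Module.Finite.of_function_exact ψ φ ?_ h inferInstance
    intro y
    constructor
    · intro hy
      refine ⟨⟨y, ?_⟩, rfl⟩
      have hle : a ≤ Ideal.torsionOf R M (y : M) :=
        hs.symm.le.trans (Submodule.span_le.2 fun x hx =>
          congrArg Subtype.val (congrFun hy ⟨x, hx⟩))
      rw [mem_torsionBySet_ideal]
      exact fun r hr => hle hr
    · rintro ⟨y, rfl⟩
      ext x
      exact mem_torsionBySet_ideal.1 y.2 _ (hs ▸ Submodule.subset_span x.2)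

variable {a} in
lemma ExtFin.of_pow_smul_eq_zero (h : ExtFin a M 0) {k : ℕ}
    (hk : ∀ r ∈ a ^ k, ∀ x : M, r • x = 0) : Module.Finite R M := by
  have := h.torsion_pow k
  have htop : Submodule.torsionBySet R M ((a ^ k : Ideal R) : Set R) = ⊤ := by
    ext x
    simpa [mem_torsionBySet_ideal] using fun r hr => hk r hr x
  rw [htop] at this
  exact Module.Finite.equiv Submodule.topEquiv

/-- Melkersson's criterion: multiplication by `x ∈ a`. -/
lemma extFin_of_ker_of_range {x : R} (hx : x ∈ a)
    (hker : ∀ i, ExtFin a (LinearMap.ker (LinearMap.lsmul R M x)) i)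
    (hcoker : ∀ i, ExtFin a (M ⧸ LinearMap.range (LinearMap.lsmul R M x)) i) (i : ℕ) :
    ExtFin a M i := by
  let μ := LinearMap.lsmul R M x
  let p : M →ₗ[R] LinearMap.range μ := μ.rangeRestrict
  let q : LinearMap.range μ →ₗ[R] M := Submodule.subtype _
  have hp : Function.Exact (Submodule.subtype (LinearMap.ker μ)) p := by
    rw [LinearMap.exact_iff]; simp [p]
  have hq : Function.Exact q (Submodule.mkQ (LinearMap.range μ)) := by
    rw [LinearMap.exact_iff]; simp [q]
  have hps : Function.Surjective p := LinearMap.surjective_rangeRestrict _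
  have hqs := Submodule.mkQ_surjective (LinearMap.range μ)
  have hqi : Function.Injective q := Submodule.injective_subtype _
  have hpi := Submodule.injective_subtype (LinearMap.ker μ)
  have hzero : ∀ i y, ExtM.post (R ⧸ a) i q (ExtM.post (R ⧸ a) i p y) = 0 := by
    intro i y
    rw [← LinearMap.comp_apply, ← ExtM.post_comp]
    have : q ∘ₗ p = x • LinearMap.id := by ext; rfl
    rw [this, ExtM.post_smul_id]
    refine ExtM.smul_eq_zero_of_left _ _ _ _ (fun y => ?_) _
    obtain ⟨y, rfl⟩ := Ideal.Quotient.mk_surjective y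
    rw [Algebra.smul_def, Ideal.Quotient.algebraMap_eq, Ideal.Quotient.eq_zero_iff_mem.2 hx,
      zero_mul]
  refine ExtFin.mid hpi hp hps (hker i) ?_
  have hker_fin : Module.Finite R (LinearMap.ker (ExtM.post (R ⧸ a) i q)) := by
    cases i with
    | zero =>
      rw [LinearMap.ker_eq_bot.2 (ExtM.post_zero_injective (R ⧸ a) hqi)]
      infer_instance
    | succ i =>
      rw [LinearMap.exact_iff.1 (ExtM.exact_delta_post (R ⧸ a) hqi hq hqs i)]
      have : Module.Finite R (ExtM R (R ⧸ a) _ i) := hcoker i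
      infer_instance
  have hle : LinearMap.range (ExtM.post (R ⧸ a) i p) ≤ LinearMap.ker (ExtM.post (R ⧸ a) i q) := by
    rintro _ ⟨y, rfl⟩
    exact hzero i y
  refine Module.Finite.of_function_exact (LinearMap.range (ExtM.post (R ⧸ a) i p)).subtype
    (ExtM.delta (R ⧸ a) hpi hp hps i) ?_
    (Module.Finite.of_injective _ (Submodule.inclusion_injective hle)) (hker (i + 1))
  rw [LinearMap.exact_iff, Submodule.range_subtype]
  exact LinearMap.exact_iff.1 (ExtM.exact_post_delta (R ⧸ a) hpi hp hps i)

end FiniteExt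

section Devissage

variable {R : Type u} [CommRing R] [IsNoetherianRing R] {a : Ideal R}

/-- A dévissage principle for finiteness of `Ext^i(R/a, T)`. -/
lemma extFin_of_devissage
    (D : ∀ (T : Type u) [AddCommGroup T] [Module R T], Prop)
    (zero : ∀ (T : Type u) [AddCommGroup T] [Module R T], D T → ExtFin a T 0)
    (ker : ∀ (T : Type u) [AddCommGroup T] [Module R T], D T → ∀ x ∈ a, ∀ m : ℕ,
      D (LinearMap.ker (LinearMap.lsmul R T (x ^ m))))
    (range : ∀ (T : Type u) [AddCommGroup T] [Module R T], D T → ∀ x ∈ a,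
      (∀ m i, ExtFin a (LinearMap.ker (LinearMap.lsmul R T (x ^ m))) i) →
      ∃ m, D (LinearMap.range (LinearMap.lsmul R T (x ^ m))) ∧
        ((∀ i, ExtFin a
          (LinearMap.ker (LinearMap.lsmul R (LinearMap.range (LinearMap.lsmul R T (x ^ m))) x)) i) →
        ∀ i, ExtFin a (LinearMap.range (LinearMap.lsmul R T (x ^ m)) ⧸
          LinearMap.range (LinearMap.lsmul R (LinearMap.range (LinearMap.lsmul R T (x ^ m))) x)) i))
    (T : Type u) [AddCommGroup T] [Module R T] (hT : D T) (i : ℕ) : ExtFin a T i := by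
  have key : ∀ (s : Finset R) (b : Ideal R), a = Ideal.span s ⊔ b →
      ∀ (T : Type u) [AddCommGroup T] [Module R T], D T →
      (∃ k, b ^ k ≤ Module.annihilator R T) → ∀ i, ExtFin a T i := by
    classical
    intro s
    induction s using Finset.induction_on with
    | empty =>
      rintro b hb T _ _ hT ⟨k, hk⟩ i
      have hab : a = b := by simpa using hb
      subst hab
      have := (zero T hT).of_pow_smul_eq_zero
        (fun r hr x => Module.mem_annihilator.1 (hk hr) x)
      exact extFin_of_finite a i
    | insert x s _ ih =>
      rintro b hb T _ _ hT ⟨k, hk⟩ i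
      have hb' : a = Ideal.span s ⊔ (Ideal.span {x} ⊔ b) := by
        rw [hb, Finset.coe_insert, Ideal.span_insert, sup_comm (Ideal.span {x}), sup_assoc]
      have hx : x ∈ a := by
        rw [hb]
        exact Ideal.mem_sup_left (Ideal.subset_span (by simp))
      have hann : ∀ (T : Type u) [AddCommGroup T] [Module R T] (m : ℕ),
          b ^ k ≤ Module.annihilator R T → (∀ t : T, x ^ m • t = 0) →
          ∃ l, (Ideal.span {x} ⊔ b) ^ l ≤ Module.annihilator R T := by
        intro T _ _ m h1 h2
        refine ⟨m + k, Ideal.sup_pow_add_le_pow_sup_pow.trans (sup_le ?_ h1)⟩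
        rw [Ideal.span_singleton_pow, Ideal.span_singleton_le_iff_mem]
        exact Module.mem_annihilator.2 h2
      have hker : ∀ (T : Type u) [AddCommGroup T] [Module R T], D T →
          b ^ k ≤ Module.annihilator R T → ∀ m i,
          ExtFin a (LinearMap.ker (LinearMap.lsmul R T (x ^ m))) i := by
        intro T _ _ hT h m
        refine ih _ hb' _ (ker T hT x hx m) (hann _ m ?_ fun t => Subtype.ext t.2)
        exact h.trans (LinearMap.annihilator_le_of_injective _ (Submodule.injective_subtype _))
      obtain ⟨m, hm, hq⟩ := range T hT x hx (hker T hT hk)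
      have hk' : b ^ k ≤ Module.annihilator R (LinearMap.range (LinearMap.lsmul R T (x ^ m))) :=
        hk.trans (LinearMap.annihilator_le_of_injective _ (Submodule.injective_subtype _))
      have h1 := hker _ hm hk' 1
      rw [pow_one] at h1
      refine ExtFin.mid (Submodule.injective_subtype _) ?_
        (LinearMap.surjective_rangeRestrict (LinearMap.lsmul R T (x ^ m)))
        (hker T hT hk m i) (extFin_of_ker_of_range a hx h1 (hq h1) i)
      rw [LinearMap.exact_iff]
      simp
  obtain ⟨s, hs⟩ := (isNoetherianRing_iff_ideal_fg R).1 inferInstance a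
  refine key s ⊥ (by simpa using hs.symm) T hT ⟨1, by simp⟩ i

/-- For Artinian modules, finiteness of `Hom(R/a, T)` suffices. -/
lemma extFin_of_isArtinian (T : Type u) [AddCommGroup T] [Module R T] [IsArtinian R T]
    (hT : ExtFin a T 0) (i : ℕ) : ExtFin a T i := by
  refine extFin_of_devissage (fun T _ _ => IsArtinian R T ∧ ExtFin a T 0) (fun T _ _ h => h.2)
    (fun T _ _ h x hx m => ?_) (fun T _ _ h x hx hker => ?_) T ⟨inferInstance, hT⟩ i
  · have := h.1
    exact ⟨inferInstance, h.2.of_injective (Submodule.injective_subtype _)⟩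
  · have := h.1
    obtain ⟨m, hm⟩ := IsArtinian.range_smul_pow_stabilizes T x
    have hm' : ∀ t : T, ∃ t' : T, x ^ (m + 1) • t' = x ^ m • t := by
      intro t
      have : x ^ m • t ∈ LinearMap.range (x ^ m • LinearMap.id : T →ₗ[R] T) := ⟨t, rfl⟩
      rw [hm (m + 1) (by simp)] at this
      exact this
    refine ⟨m, ⟨inferInstance, h.2.of_injective (Submodule.injective_subtype _)⟩, fun _ i => ?_⟩
    have htop : LinearMap.range (LinearMap.lsmul R (LinearMap.range
        (LinearMap.lsmul R T (x ^ m))) x)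
        = ⊤ := by
      rw [LinearMap.range_eq_top]
      rintro ⟨_, t, rfl⟩
      obtain ⟨t', ht'⟩ := hm' t
      refine ⟨⟨x ^ m • t', t', rfl⟩, Subtype.ext ?_⟩
      change x • x ^ m • t' = x ^ m • t
      rw [smul_smul, ← pow_succ', ht']
    rw [htop]
    exact extFin_of_subsingleton a i

end Devissage

section Artinian

variable {A : Type*} [CommRing A] {T : Type*} [AddCommGroup T] [Module A T]

lemma Antitone.stabilizes_of_le {P : Submodule A T} [IsArtinian A P] {f : ℕ → Submodule A T}
    (hf : Antitone f) (hP : ∀ j, f j ≤ P) : ∃ n, ∀ m, n ≤ m → f n = f m := by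
  let F : ℕ →o (Submodule A P)ᵒᵈ :=
    ⟨fun j => OrderDual.toDual ((f j).comap P.subtype), fun i j hij => by
      exact Submodule.comap_mono (hf hij)⟩
  obtain ⟨n, hn⟩ := IsArtinian.monotone_stabilizes F
  refine ⟨n, fun m hm => ?_⟩
  have h : (f n).comap P.subtype = (f m).comap P.subtype := hn m hm
  replace h := congrArg (Submodule.map P.subtype) h
  rwa [Submodule.map_comap_subtype, Submodule.map_comap_subtype, inf_eq_right.2 (hP n),
    inf_eq_right.2 (hP m)] at h

lemma isArtinian_of_ker_of_nilpotent (x : A) (hx : ∀ t : T, ∃ k : ℕ, x ^ k • t = 0)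
    (hker : IsArtinian A (LinearMap.ker (LinearMap.lsmul A T x))) : IsArtinian A T := by
  let μ (k : ℕ) := LinearMap.lsmul A T (x ^ k)
  let L (k : ℕ) (N : Submodule A T) : Submodule A T :=
    Submodule.map (μ k) (N ⊓ LinearMap.ker (μ (k + 1)))
  have hL : ∀ k N, L k N ≤ LinearMap.ker (LinearMap.lsmul A T x) := by
    rintro k N _ ⟨t, ⟨_, ht⟩, rfl⟩
    change x • x ^ k • t = 0
    rw [smul_smul, ← pow_succ']
    exact ht
  have hLmono : ∀ k, Monotone (L k) := fun k N N' h => Submodule.map_mono (inf_le_inf_right _ h)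
  have hLanti : ∀ N, Antitone (fun k => L k N) := by
    intro N
    refine antitone_nat_of_succ_le fun k => ?_
    rintro _ ⟨t, ⟨htN, ht⟩, rfl⟩
    refine ⟨x • t, ⟨N.smul_mem x htN, ?_⟩, ?_⟩
    · change x ^ (k + 1) • x • t = 0
      rw [smul_smul, ← pow_succ]
      exact ht
    · change x ^ k • x • t = x ^ (k + 1) • t
      rw [smul_smul, ← pow_succ]
  rw [← monotone_stabilizes_iff_artinian]
  intro F
  let N (j : ℕ) : Submodule A T := OrderDual.ofDual (F j)
  have hN : Antitone N := fun i j hij => F.monotone hij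
  obtain ⟨n₀, h₀⟩ := Antitone.stabilizes_of_le (f := fun j => L j (N j))
    (fun i j hij => (hLanti _ hij).trans (hLmono _ (hN hij))) (fun j => hL _ _)
  have hk : ∀ k, ∃ n, ∀ m, n ≤ m → L k (N n) = L k (N m) := fun k =>
    Antitone.stabilizes_of_le (fun i j hij => hLmono k (hN hij)) (fun j => hL _ _)
  choose n hn using hk
  let M := n₀ + (Finset.range n₀).sup n
  refine ⟨M, fun m hm => ?_⟩
  have hLeq : ∀ k, L k (N M) = L k (N m) := by
    intro k
    by_cases hkn : k < n₀
    · have h1 : n k ≤ M := (Finset.le_sup (Finset.mem_range.2 hkn)).trans (Nat.le_add_left _ _)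
      rw [← hn k M h1, hn k m (h1.trans hm)]
    · push Not at hkn
      refine le_antisymm ?_ (hLmono k (hN hm))
      have hM : n₀ ≤ M := Nat.le_add_right _ _
      calc L k (N M) ≤ L n₀ (N n₀) := (hLanti _ hkn).trans (hLmono _ (hN hM))
        _ = L (max k m) (N (max k m)) := h₀ _ (hkn.trans (le_max_left _ _))
        _ ≤ L k (N m) := (hLanti _ (le_max_left _ _)).trans (hLmono _ (hN (le_max_right _ _)))
  suffices h : N M ≤ N m from le_antisymm (α := Submodule A T) h (hN hm)
  have main : ∀ k, ∀ t ∈ N M, x ^ k • t = 0 → t ∈ N m := by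
    intro k
    induction k with
    | zero => intro t _ ht; rw [pow_zero, one_smul] at ht; simp [ht]
    | succ k ih =>
      intro t ht htk
      have : x ^ k • t ∈ L k (N m) := by
        rw [← hLeq]
        exact ⟨t, ⟨ht, htk⟩, rfl⟩
      obtain ⟨z, ⟨hz, -⟩, hzt⟩ := this
      have h := ih (t - z) (sub_mem ht (hN hm hz)) (by
        rw [smul_sub, sub_eq_zero]; exact hzt.symm)
      simpa using add_mem h hz
  intro t ht
  obtain ⟨k, hk⟩ := hx t
  exact main k t ht hk

lemma isArtinian_of_torsion_of_nilpotent (s : Finset A)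
    (hs : ∀ x ∈ s, ∀ t : T, ∃ k : ℕ, x ^ k • t = 0)
    (hT : IsArtinian A (Submodule.torsionBySet A T (s : Set A))) : IsArtinian A T := by
  classical
  induction s using Finset.induction_on generalizing T with
  | empty =>
    have : Submodule.torsionBySet A T ((∅ : Finset A) : Set A) = ⊤ := by ext; simp
    rw [this] at hT
    exact isArtinian_of_linearEquiv Submodule.topEquiv
  | insert x s _ ih =>
    refine isArtinian_of_ker_of_nilpotent x (hs x (by simp)) (ih (fun y hy t => ?_) ?_)
    · obtain ⟨k, hk⟩ := hs y (by simp [hy]) t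
      exact ⟨k, Subtype.ext hk⟩
    · let φ : Submodule.torsionBySet A (LinearMap.ker (LinearMap.lsmul A T x)) (s : Set A) →ₗ[A]
          Submodule.torsionBySet A T ((insert x s : Finset A) : Set A) :=
        LinearMap.codRestrict _ (Submodule.subtype _ ∘ₗ Submodule.subtype _) fun t => by
          rw [Submodule.mem_torsionBySet_iff]
          rintro ⟨y, hy⟩
          rcases Finset.mem_insert.1 hy with rfl | hy
          · exact t.1.2
          · exact congrArg Subtype.val ((Submodule.mem_torsionBySet_iff _ _).1 t.2 ⟨y, hy⟩)
      refine isArtinian_of_injective φ fun t t' h => ?_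
      have h' := congrArg (Submodule.subtype _) h
      exact Subtype.ext (Subtype.ext h')

lemma isArtinian_of_support_maximal {A : Type u} [CommRing A] [IsNoetherianRing A]
    {T : Type u} [AddCommGroup T] [Module A T]
    (hfin : Module.Finite A T) (h : ∀ p ∈ Module.support A T, p.asIdeal.IsMaximal) :
    IsArtinian A T := by
  induction hfin using IsNoetherianRing.induction_on_isQuotientEquivQuotientPrime A with
  | subsingleton N => infer_instance
  | quotient N p e =>
    have hp : p ∈ Module.support A N := by
      rw [e.support_eq, Module.support_eq_zeroLocus, Ideal.annihilator_quotient]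
      exact fun x hx => hx
    have := h p hp
    have : IsSimpleModule A N := isSimpleModule_iff_quot_maximal.2 ⟨_, this, ⟨e⟩⟩
    infer_instance
  | exact N₁ N₂ N₃ f g hf hg hfg h₁ h₃ =>
    have := h₁ fun p hp => h p (Module.support_subset_of_injective f hf hp)
    have := h₃ fun p hp => h p (Module.support_subset_of_surjective g hg hp)
    exact isArtinian_of_range_eq_ker f g (LinearMap.exact_iff.1 hfg).symm

end Artinian

section DimensionOne

variable {R : Type u} [CommRing R]

lemma le_of_mem_support_of_nilpotent {c : Ideal R} {T : Type*} [AddCommGroup T] [Module R T]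
    (hT : ∀ t : T, ∀ x ∈ c, ∃ k : ℕ, x ^ k • t = 0) {p : PrimeSpectrum R}
    (hp : p ∈ Module.support R T) : c ≤ p.asIdeal := by
  obtain ⟨t, ht⟩ := Module.mem_support_iff_exists_annihilator.1 hp
  intro x hx
  obtain ⟨k, hk⟩ := hT t x hx
  exact p.2.mem_of_pow_mem k (ht (Submodule.mem_annihilator_span_singleton t _ |>.2 hk))

lemma torsionBySet_span {M : Type*} [AddCommGroup M] [Module R M] (s : Set R) :
    Submodule.torsionBySet R M (Ideal.span s : Set R) = Submodule.torsionBySet R M s :=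
  (Submodule.torsionBySet_eq_torsionBySet_span s).symm

variable [IsNoetherianRing R]

lemma isArtinian_localizedModule {a c : Ideal R} (hac : a ≤ c) {T : Type u} [AddCommGroup T]
    [Module R T] (hT : ∀ t : T, ∀ x ∈ c, ∃ k : ℕ, x ^ k • t = 0) (h0 : ExtFin a T 0)
    (p : Ideal R) [p.IsPrime] (hp : p ∈ c.minimalPrimes) :
    IsArtinian (Localization.AtPrime p) (LocalizedModule p.primeCompl T) := by
  classical
  obtain ⟨s, hs⟩ := (isNoetherianRing_iff_ideal_fg R).1 inferInstance a
  have hnil : ∀ t : LocalizedModule p.primeCompl T, ∀ x ∈ c, ∃ k : ℕ,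
      (algebraMap R (Localization.AtPrime p) x) ^ k • t = 0 := by
    intro t x hx
    induction t using LocalizedModule.induction_on with
    | h t u =>
      obtain ⟨k, hk⟩ := hT t x hx
      refine ⟨k, ?_⟩
      rw [← map_pow, algebraMap_smul, LocalizedModule.smul'_mk, hk, LocalizedModule.zero_mk]
  let s' : Finset (Localization.AtPrime p) := s.image (algebraMap R _)
  refine isArtinian_of_torsion_of_nilpotent s' ?_ ?_
  · intro x hx t
    obtain ⟨y, hy, rfl⟩ := Finset.mem_image.1 hx
    exact hnil t y (hac (hs ▸ Ideal.subset_span hy))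
  · let U := Submodule.torsionBySet (Localization.AtPrime p) (LocalizedModule p.primeCompl T)
      (s' : Set _)
    change IsArtinian _ U
    refine isArtinian_of_support_maximal ?_ ?_
    · rw [extFin_zero_iff] at h0
      obtain ⟨w, hw⟩ := h0.fg_top
      let V : Submodule (Localization.AtPrime p) (LocalizedModule p.primeCompl T) :=
        Submodule.span _ ((fun t : Submodule.torsionBySet R T (a : Set R) =>
          LocalizedModule.mkLinearMap p.primeCompl T t) '' w)
      have hV : ∀ t ∈ Submodule.torsionBySet R T (a : Set R),
          LocalizedModule.mkLinearMap p.primeCompl T t ∈ V := by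
        intro t ht
        have h : (⟨t, ht⟩ : Submodule.torsionBySet R T (a : Set R)) ∈
            Submodule.span R (w : Set _) :=
          hw ▸ Submodule.mem_top
        have h2 := Submodule.mem_map_of_mem (f := LocalizedModule.mkLinearMap p.primeCompl T ∘ₗ
          Submodule.subtype _) h
        rw [Submodule.map_span] at h2
        exact Submodule.span_le_restrictScalars R (Localization.AtPrime p) _ h2
      have hUV : U ≤ V := by
        intro y hy
        induction y using LocalizedModule.induction_on with
        | h t u =>
          have hu : ∀ x : s, ∃ v : p.primeCompl, v • (x : R) • t = 0 := by
            intro x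
            have h1 := (Submodule.mem_torsionBySet_iff _ _).1 hy
              ⟨algebraMap R _ (x : R), Finset.mem_image_of_mem _ x.2⟩
            change (algebraMap R (Localization.AtPrime p) (x : R)) •
              LocalizedModule.mk t u = 0 at h1
            rw [algebraMap_smul, LocalizedModule.smul'_mk, ← LocalizedModule.zero_mk 1,
              LocalizedModule.mk_eq] at h1
            obtain ⟨v, hv⟩ := h1
            exact ⟨v, by simpa using hv⟩
          choose v hv using hu
          let v₀ : p.primeCompl := ∏ x, v x
          have hv₀ : v₀ • t ∈ Submodule.torsionBySet R T (a : Set R) := by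
            rw [← hs, torsionBySet_span, Submodule.mem_torsionBySet_iff]
            intro x
            obtain ⟨z, hz⟩ := Finset.dvd_prod_of_mem v (Finset.mem_univ (⟨x, x.2⟩ : s))
            have : v₀ = z * v ⟨x, x.2⟩ := by rw [mul_comm]; exact hz
            rw [this, smul_comm, mul_smul, hv, smul_zero]
          have h1 : LocalizedModule.mk t u = Localization.mk 1 (v₀ * u) •
              LocalizedModule.mkLinearMap p.primeCompl T (v₀ • t) := by
            rw [LocalizedModule.mkLinearMap_apply, LocalizedModule.mk_smul_mk, one_smul, mul_one,
              LocalizedModule.mk_eq]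
            exact ⟨1, by simp [smul_smul, mul_comm]⟩
          rw [h1]
          exact V.smul_mem _ (hV _ hv₀)
      have hVfin : Module.Finite (Localization.AtPrime p) V :=
        Module.Finite.iff_fg.2 (Submodule.fg_span ((Finset.finite_toSet w).image _))
      exact Module.Finite.of_injective _ (Submodule.inclusion_injective hUV)
    · intro q hq
      have hle : c ≤ q.asIdeal.comap (algebraMap R (Localization.AtPrime p)) := by
        rw [← Ideal.map_le_iff_le_comap]
        obtain ⟨t, ht⟩ := Module.mem_support_iff_exists_annihilator.1 hq
        rw [Ideal.map_le_iff_le_comap]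
        intro x hx
        obtain ⟨k, hk⟩ := hnil t x hx
        exact q.2.mem_of_pow_mem k
          (ht ((Submodule.mem_annihilator_span_singleton t _).2 (Subtype.ext hk)))
      have hqm : q.asIdeal ≤ IsLocalRing.maximalIdeal (Localization.AtPrime p) :=
        IsLocalRing.le_maximalIdeal q.2.ne_top
      have hcm : (IsLocalRing.maximalIdeal (Localization.AtPrime p)).comap
          (algebraMap R (Localization.AtPrime p)) = p :=
        IsLocalization.AtPrime.under_maximalIdeal _ _
      have hqp : q.asIdeal.comap (algebraMap R (Localization.AtPrime p)) = p :=
        le_antisymm ((Ideal.comap_mono hqm).trans hcm.le)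
          (hp.2 ⟨Ideal.IsPrime.comap _, hle⟩ ((Ideal.comap_mono hqm).trans hcm.le))
      have : q.asIdeal = IsLocalRing.maximalIdeal (Localization.AtPrime p) := by
        have hmap (J : Ideal (Localization.AtPrime p)) :
            (J.comap (algebraMap R (Localization.AtPrime p))).map (algebraMap R _) = J :=
          IsLocalization.map_under p.primeCompl _ J
        rw [← hmap q.asIdeal, hqp, ← hmap (IsLocalRing.maximalIdeal _), hcm]
      rw [this]
      infer_instance

lemma exists_smul_pow_mem_range {a c : Ideal R} (hac : a ≤ c) {T : Type u} [AddCommGroup T]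
    [Module R T] (hT : ∀ t : T, ∀ x ∈ c, ∃ k : ℕ, x ^ k • t = 0) (h0 : ExtFin a T 0)
    (p : Ideal R) [p.IsPrime] (hp : p ∈ c.minimalPrimes) (x : R) :
    ∃ n, ∀ m, n ≤ m → ∀ t : T, ∃ s ∉ p, ∃ t' : T, s • x ^ m • t = x ^ (m + 1) • t' := by
  have := isArtinian_localizedModule hac hT h0 p hp
  obtain ⟨n, hn⟩ := IsArtinian.range_smul_pow_stabilizes (LocalizedModule p.primeCompl T)
    (algebraMap R (Localization.AtPrime p) x)
  refine ⟨n, fun m hm t => ?_⟩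
  have h1 : (algebraMap R (Localization.AtPrime p) x) ^ m • LocalizedModule.mk t 1 ∈
      LinearMap.range ((algebraMap R (Localization.AtPrime p) x) ^ m • LinearMap.id :
        LocalizedModule p.primeCompl T →ₗ[Localization.AtPrime p] _) := ⟨_, rfl⟩
  rw [← hn m hm, hn (m + 1) (by omega)] at h1
  obtain ⟨y, hy⟩ := h1
  induction y using LocalizedModule.induction_on with
  | h t' u =>
    change (algebraMap R (Localization.AtPrime p) x) ^ (m + 1) • LocalizedModule.mk t' u = _ at hy
    rw [← map_pow, ← map_pow, algebraMap_smul, algebraMap_smul, LocalizedModule.smul'_mk,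
      LocalizedModule.smul'_mk, LocalizedModule.mk_eq] at hy
    obtain ⟨v, hv⟩ := hy
    refine ⟨v * u, (v * u).2, (v : R) • t', ?_⟩
    rw [one_smul] at hv
    rw [smul_comm _ (v : R), mul_smul]
    exact hv.symm

lemma extFin_of_minimalPrimes {a c : Ideal R} (hac : a ≤ c)
    (hc : ∀ p : Ideal R, p.IsPrime → c ≤ p → p.IsMaximal ∨ p ∈ c.minimalPrimes)
    (T : Type u) [AddCommGroup T] [Module R T]
    (hT : ∀ t : T, ∀ x ∈ c, ∃ k : ℕ, x ^ k • t = 0) (h0 : ExtFin a T 0) (h1 : ExtFin a T 1)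
    (i : ℕ) : ExtFin a T i := by
  have hex : ∀ (T : Type u) [AddCommGroup T] [Module R T] (y : R),
      Function.Exact (Submodule.subtype (LinearMap.ker (LinearMap.lsmul R T y)))
        (LinearMap.lsmul R T y).rangeRestrict := by
    intro T _ _ y
    rw [LinearMap.exact_iff]
    simp
  refine extFin_of_devissage (fun T _ _ => (∀ t : T, ∀ x ∈ c, ∃ k : ℕ, x ^ k • t = 0) ∧
    ExtFin a T 0 ∧ ExtFin a T 1) (fun T _ _ h => h.2.1)
    (fun T _ _ h x hx m => ?_) (fun T _ _ h x hx hker => ?_) T ⟨hT, h0, h1⟩ i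
  · obtain ⟨hT, h0, h1⟩ := h
    refine ⟨fun t y hy => ?_, h0.of_injective (Submodule.injective_subtype _),
      ExtFin.left (Submodule.injective_subtype _) (hex T _) (LinearMap.surjective_rangeRestrict _)
        (h0.of_injective (Submodule.injective_subtype _)) h1⟩
    obtain ⟨k, hk⟩ := hT t y hy
    exact ⟨k, Subtype.ext hk⟩
  · obtain ⟨hT, h0, h1⟩ := h
    have hfin := c.finite_minimalPrimes_of_isNoetherianRing
    have hm : ∃ m, ∀ p ∈ c.minimalPrimes, ∀ t : T, ∃ s ∉ p, ∃ t' : T,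
        s • x ^ m • t = x ^ (m + 1) • t' := by
      have : ∀ p : c.minimalPrimes, ∃ n, ∀ m, n ≤ m → ∀ t : T, ∃ s ∉ (p : Ideal R), ∃ t' : T,
          s • x ^ m • t = x ^ (m + 1) • t' := by
        rintro ⟨p, hp⟩
        have : p.IsPrime := hp.1.1
        exact exists_smul_pow_mem_range hac hT h0 p hp x
      choose n hn using this
      have := hfin.fintype
      refine ⟨Finset.univ.sup n, fun p hp t => hn ⟨p, hp⟩ _ (Finset.le_sup (Finset.mem_univ _)) t⟩
    obtain ⟨m, hm⟩ := hm
    let T' := LinearMap.range (LinearMap.lsmul R T (x ^ m))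
    have hT' : ∀ t : T', ∀ x ∈ c, ∃ k : ℕ, x ^ k • t = 0 := by
      intro t y hy
      obtain ⟨k, hk⟩ := hT t y hy
      exact ⟨k, Subtype.ext hk⟩
    have h0' : ExtFin a T' 0 := h0.of_injective (Submodule.injective_subtype _)
    have h1' : ExtFin a T' 1 := ExtFin.right (Submodule.injective_subtype _) (hex T _)
      (LinearMap.surjective_rangeRestrict _) h1 (hker m 2)
    refine ⟨m, ⟨hT', h0', h1'⟩, fun hk => ?_⟩
    let W := T' ⧸ LinearMap.range (LinearMap.lsmul R T' x)
    have hW0 : ExtFin a W 0 := by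
      refine ExtFin.right (Submodule.injective_subtype _) ?_ (Submodule.mkQ_surjective _) h0'
        (ExtFin.right (Submodule.injective_subtype _) (hex T' x)
          (LinearMap.surjective_rangeRestrict _) h1' (hk 2))
      rw [LinearMap.exact_iff, Submodule.range_subtype]
      exact Submodule.ker_mkQ _
    have hWnil : ∀ t : W, ∀ x ∈ c, ∃ k : ℕ, x ^ k • t = 0 := by
      intro t y hy
      obtain ⟨t, rfl⟩ := Submodule.mkQ_surjective _ t
      obtain ⟨k, hk⟩ := hT' t y hy
      exact ⟨k, by rw [← map_smul, hk, map_zero]⟩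
    have hWmax : ∀ p ∈ Module.support R W, p.asIdeal.IsMaximal := by
      intro p hp
      refine (hc p.asIdeal p.2 (le_of_mem_support_of_nilpotent hWnil hp)).resolve_right
        fun hpc => ?_
      obtain ⟨w, hw⟩ := Module.mem_support_iff_exists_annihilator.1 hp
      obtain ⟨⟨_, t, rfl⟩, rfl⟩ := Submodule.mkQ_surjective _ w
      obtain ⟨s, hs, t', ht'⟩ := hm _ hpc t
      refine hs (hw ((Submodule.mem_annihilator_span_singleton _ _).2 ?_))
      rw [← map_smul, Submodule.mkQ_apply, Submodule.Quotient.mk_eq_zero]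
      refine ⟨⟨x ^ m • t', t', rfl⟩, Subtype.ext ?_⟩
      change x • x ^ m • t' = s • x ^ m • t
      rw [ht', smul_smul, pow_succ']
    obtain ⟨s, hs⟩ := (isNoetherianRing_iff_ideal_fg R).1 inferInstance a
    have : IsArtinian R W := by
      refine isArtinian_of_torsion_of_nilpotent s
        (fun y hy t => hWnil t y (hac (hs ▸ Ideal.subset_span hy))) ?_
      refine isArtinian_of_support_maximal ?_ fun p hp =>
        hWmax p (Module.support_subset_of_injective _ (Submodule.injective_subtype _) hp)
      rw [← torsionBySet_span, hs]
      exact (extFin_zero_iff a).1 hW0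
    exact extFin_of_isArtinian W hW0

end DimensionOne

section DimensionTwo

variable {R : Type u} [CommRing R]

lemma isMaximal_or_mem_minimalPrimes (hdim : ringKrullDim R ≤ 2) (a b : Ideal R)
    (hab : ∀ q ∈ b.minimalPrimes, ¬ a ≤ q) (p : Ideal R) (hp : p.IsPrime) (hle : a ⊔ b ≤ p) :
    p.IsMaximal ∨ p ∈ (a ⊔ b).minimalPrimes := by
  by_contra! hcon
  obtain ⟨p₀, hp₀, hp₀p⟩ := Ideal.exists_minimalPrimes_le hle
  have hlt : p₀ < p := lt_of_le_of_ne hp₀p fun h => hcon.2 (h ▸ hp₀)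
  have := hp₀.1.1
  obtain ⟨q, hq, hqp⟩ := Ideal.exists_minimalPrimes_le (le_sup_right.trans hp₀.1.2)
  have hlt' : q < p₀ := lt_of_le_of_ne hqp fun h => hab q hq (h ▸ le_sup_left.trans hp₀.1.2)
  obtain ⟨m, hm, hpm⟩ := Ideal.exists_le_maximal p hp.ne_top
  have hlt'' : p < m := lt_of_le_of_ne hpm fun h => hcon.1 (h ▸ hm)
  let l : LTSeries (PrimeSpectrum R) :=
    { length := 3
      toFun := ![⟨q, hq.1.1⟩, ⟨p₀, this⟩, ⟨p, hp⟩, ⟨m, hm.isPrime⟩]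
      step := fun i => by
        fin_cases i
        · exact hlt'
        · exact hlt
        · exact hlt'' }
  have h3 : ((l.length : ℕ∞) : WithBot ℕ∞) ≤ ringKrullDim R :=
    Order.LTSeries.length_le_krullDim l
  have h4 := h3.trans hdim
  have hl : l.length = 3 := rfl
  rw [hl] at h4
  exact absurd h4 (by decide)

variable [IsNoetherianRing R]

lemma exists_torsion_pow_stable (a : Ideal R) :
    ∃ n, ∀ m, Submodule.torsionBySet R R ((a ^ m : Ideal R) : Set R) ≤
      Submodule.torsionBySet R R ((a ^ n : Ideal R) : Set R) := by
  have hmono : Monotone fun m => Submodule.torsionBySet R R ((a ^ m : Ideal R) : Set R) :=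
    fun i j hij => Submodule.torsionBySet_le_torsionBySet_of_subset (Ideal.pow_le_pow_right hij)
  obtain ⟨n, hn⟩ := monotone_stabilizes_iff_noetherian.2 (inferInstance : IsNoetherian R R)
    ⟨_, hmono⟩
  refine ⟨n, fun m => ?_⟩
  rcases le_total m n with h | h
  · exact hmono h
  · exact (hn m h).ge

lemma not_le_of_mem_minimalPrimes_torsion (a : Ideal R) (n : ℕ)
    (hn : ∀ m, Submodule.torsionBySet R R ((a ^ m : Ideal R) : Set R) ≤
      Submodule.torsionBySet R R ((a ^ n : Ideal R) : Set R)) (q : Ideal R)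
    (hq : q ∈ Ideal.minimalPrimes (Submodule.torsionBySet R R ((a ^ n : Ideal R) : Set R))) :
    ¬ a ≤ q := by
  intro haq
  rw [← Ideal.annihilator_quotient (I := Submodule.torsionBySet R R ((a ^ n : Ideal R) : Set R))]
    at hq
  obtain ⟨hqp, r, hr⟩ := isAssociatedPrime_iff.1
    (Module.associatedPrimes.minimalPrimes_annihilator_subset_associatedPrimes R _ hq)
  obtain ⟨r, rfl⟩ := Ideal.Quotient.mk_surjective r
  refine hqp.ne_top ((Ideal.eq_top_iff_one _).2 ?_)
  have hmem (s : R) : s ∈ q ↔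
      s * r ∈ Submodule.torsionBySet R R ((a ^ n : Ideal R) : Set R) := by
    rw [hr, Submodule.mem_colon_singleton, Submodule.mem_bot, Algebra.smul_def,
      Ideal.Quotient.algebraMap_eq, ← map_mul, Ideal.Quotient.eq_zero_iff_mem]
  rw [hmem, one_mul]
  refine hn (n + 1) (mem_torsionBySet_ideal.2 fun s hs => ?_)
  have hle : a ^ (n + 1) ≤ Ideal.torsionOf R R r := by
    rw [pow_succ, Ideal.mul_le]
    intro u hu v hv
    have := mem_torsionBySet_ideal.1 ((hmem v).1 (haq hv)) u hu
    rw [Ideal.mem_torsionOf_iff]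
    simpa [mul_assoc] using this
  exact hle hs

/-- Over a ring of dimension at most two, an `a`-torsion module `T` such that `Hom(R/a, T)` and
`Ext^1(R/a, T)` are finite satisfies finiteness for all `Ext^i(R/a, T)`. -/
lemma extFin_of_torsion_of_dim_le_two (hdim : ringKrullDim R ≤ 2) (a : Ideal R)
    (T : Type u) [AddCommGroup T] [Module R T]
    (hT : ∀ t : T, ∀ x ∈ a, ∃ k : ℕ, x ^ k • t = 0) (h0 : ExtFin a T 0) (h1 : ExtFin a T 1)
    (i : ℕ) : ExtFin a T i := by
  obtain ⟨n, hn⟩ := exists_torsion_pow_stable a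
  set b : Ideal R := Submodule.torsionBySet R R ((a ^ n : Ideal R) : Set R) with hb
  let F := Submodule.torsionBySet R T ((a ^ n : Ideal R) : Set R)
  have hF : Module.Finite R F := h0.torsion_pow n
  have hex : Function.Exact F.subtype F.mkQ := by
    rw [LinearMap.exact_iff, Submodule.range_subtype]
    exact Submodule.ker_mkQ _
  have hFi := fun i => extFin_of_finite (M := F) a i
  have hinj := Submodule.injective_subtype F
  have hsurj := Submodule.mkQ_surjective F
  refine ExtFin.mid hinj hex hsurj (hFi i) ?_
  refine extFin_of_minimalPrimes (c := a ⊔ b) le_sup_left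
    (isMaximal_or_mem_minimalPrimes hdim a b (not_le_of_mem_minimalPrimes_torsion a n hn)) _
    ?_ (ExtFin.right hinj hex hsurj h0 (hFi 1)) (ExtFin.right hinj hex hsurj h1 (hFi 2)) i
  intro t x hx
  obtain ⟨y, hy, z, hz, rfl⟩ := Submodule.mem_sup.1 hx
  obtain ⟨t, rfl⟩ := hsurj t
  obtain ⟨k, hk⟩ := hT t y hy
  refine ⟨k, ?_⟩
  obtain ⟨w, hw⟩ := sub_dvd_pow_sub_pow (y + z) y k
  rw [add_sub_cancel_left, sub_eq_iff_eq_add] at hw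
  rw [hw, ← map_smul, add_smul, hk, add_zero, Submodule.mkQ_apply, Submodule.Quotient.mk_eq_zero,
    mem_torsionBySet_ideal]
  intro r hr
  rw [smul_smul, ← mul_assoc]
  have := mem_torsionBySet_ideal.1 hz r hr
  rw [smul_eq_mul] at this
  rw [this, zero_mul, zero_smul]

end DimensionTwo

section LocalCohomologyLimit

variable {R : Type u} [CommRing R] (a : Ideal R)
  (M : Type u) [AddCommGroup M] [Module R M]
  {A B C : Type u} [AddCommGroup A] [Module R A] [AddCommGroup B] [Module R B]
  [AddCommGroup C] [Module R C]

/-- The projection `R/a^m → R/a^n` for `n ≤ m`. -/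
def powProj (n m : ℕ) (h : n ≤ m) : (R ⧸ a ^ m) →ₗ[R] (R ⧸ a ^ n) :=
  Submodule.mapQ _ _ LinearMap.id (Ideal.pow_le_pow_right h)

lemma powProj_self (n : ℕ) : powProj a n n le_rfl = LinearMap.id := by
  ext; rfl

lemma powProj_comp (n m k : ℕ) (h : n ≤ m) (h' : m ≤ k) :
    powProj a n m h ∘ₗ powProj a m k h' = powProj a n k (h.trans h') := by
  ext; rfl

/-- The transition maps `Ext^j(R/a^n, M) → Ext^j(R/a^m, M)`. -/
noncomputable def extTrans (j : ℕ) (n m : ℕ) (h : n ≤ m) :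
    ExtM R (R ⧸ a ^ n) M j →ₗ[R] ExtM R (R ⧸ a ^ m) M j :=
  ExtM.pre M j (powProj a n m h)

instance (j : ℕ) : DirectedSystem (fun n => ExtM R (R ⧸ a ^ n) M j)
    (fun n m h => extTrans a M j n m h) where
  map_self n x := by
    rw [extTrans, powProj_self, ExtM.pre_id]
    rfl
  map_map n m k h h' x := by
    simp only [extTrans]
    rw [← LinearMap.comp_apply, ← ExtM.pre_comp, powProj_comp]

/-- Local cohomology as a direct limit of modules. -/
abbrev LocCoh (j : ℕ) : Type u :=
  Module.DirectLimit (fun n => ExtM R (R ⧸ a ^ n) M j) (extTrans a M j)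

/-- The structure map of the direct limit. -/
noncomputable def LocCoh.of (j n : ℕ) : ExtM R (R ⧸ a ^ n) M j →ₗ[R] LocCoh a M j :=
  Module.DirectLimit.of R ℕ (fun n => ExtM R (R ⧸ a ^ n) M j) (extTrans a M j) n

variable {M} in
lemma LocCoh.of_extTrans (j n m : ℕ) (h : n ≤ m) (x : ExtM R (R ⧸ a ^ n) M j) :
    LocCoh.of a M j m (extTrans a M j n m h x) = LocCoh.of a M j n x :=
  Module.DirectLimit.of_f

open Limits in
/-- The evaluated colimit cocone defining local cohomology is a colimit cocone. -/
noncomputable def localCohomologyIsColimit (j : ℕ) : IsColimit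
    (((evaluation (ModuleCat.{u} R) (ModuleCat.{u} R)).obj (ModuleCat.of R M)).mapCocone
      (colimit.cocone (localCohomology.diagram (localCohomology.idealPowersDiagram a) j))) :=
  isColimitOfPreserves _ (colimit.isColimit _)

open Limits in
/-- The cocone on the direct limit. -/
noncomputable def locCohCocone (j : ℕ) : Cocone
    (localCohomology.diagram (localCohomology.idealPowersDiagram a) j ⋙
      (evaluation (ModuleCat.{u} R) (ModuleCat.{u} R)).obj (ModuleCat.of R M)) where
  pt := ModuleCat.of R (LocCoh a M j)
  ι :=
    { app := fun n => ModuleCat.ofHom (LocCoh.of a M j n.unop.unop ∘ₗ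
        (extEquiv j (ModuleCat.of R M) (ModuleCat.of R (R ⧸ a ^ n.unop.unop))).toLinearMap)
      naturality := by
        intro n m h
        ext x
        refine (congrArg (LocCoh.of a M j m.unop.unop) (extEquiv_naturality j (ModuleCat.of R M)
          (ModuleCat.ofHom (powProj a n.unop.unop m.unop.unop h.unop.unop.down.down)) x)).trans ?_
        exact LocCoh.of_extTrans a j n.unop.unop m.unop.unop _ _ }

open Limits in
/-- The canonical map from a term of the direct system to local cohomology. -/
noncomputable def toLocalCohomology (j n : ℕ) : ExtM R (R ⧸ a ^ n) M j →ₗ[R]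
    ((localCohomology a j).obj (ModuleCat.of R M)) :=
  ((((evaluation (ModuleCat.{u} R) (ModuleCat.{u} R)).obj (ModuleCat.of R M)).mapCocone
    (colimit.cocone (localCohomology.diagram (localCohomology.idealPowersDiagram a) j))).ι.app
      (Opposite.op (Opposite.op n))).hom ∘ₗ
    (extEquiv j (ModuleCat.of R M) (ModuleCat.of R (R ⧸ a ^ n))).symm.toLinearMap

lemma toLocalCohomology_extTrans (j n m : ℕ) (h : n ≤ m) (x : ExtM R (R ⧸ a ^ n) M j) :
    toLocalCohomology a M j m (extTrans a M j n m h x) = toLocalCohomology a M j n x := by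
  obtain ⟨x, rfl⟩ := (extEquiv j (ModuleCat.of R M) (ModuleCat.of R (R ⧸ a ^ n))).surjective x
  have h1 := extEquiv_naturality j (ModuleCat.of R M) (ModuleCat.ofHom (powProj a n m h)) x
  have h2 := (((evaluation (ModuleCat.{u} R) (ModuleCat.{u} R)).obj (ModuleCat.of R M)).mapCocone
    (Limits.colimit.cocone (localCohomology.diagram (localCohomology.idealPowersDiagram a) j))).w
      (homOfLE h).op.op
  have h3 := LinearMap.congr_fun (congrArg ModuleCat.Hom.hom h2) x
  refine Eq.trans ?_ (h3.trans ?_)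
  · refine (congrArg (toLocalCohomology a M j m) h1.symm).trans ?_
    exact congrArg _ (LinearEquiv.symm_apply_apply _ _)
  · exact congrArg _ (LinearEquiv.symm_apply_apply _ _).symm

/-- The local cohomology functor is computed by the direct limit. -/
noncomputable def localCohomologyEquiv (j : ℕ) :
    ((localCohomology a j).obj (ModuleCat.of R M)) ≃ₗ[R] LocCoh a M j :=
  LinearEquiv.ofLinearMap ((localCohomologyIsColimit a M j).desc (locCohCocone a M j)).hom
    (Module.DirectLimit.lift R ℕ _ _ (toLocalCohomology a M j) (toLocalCohomology_extTrans a M j))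
    (by
      refine Module.DirectLimit.hom_ext fun n => LinearMap.ext fun x => ?_
      refine (congrArg _ (Module.DirectLimit.lift_of _ _ _)).trans ?_
      have h := LinearMap.congr_fun (congrArg ModuleCat.Hom.hom
        ((localCohomologyIsColimit a M j).fac (locCohCocone a M j) (Opposite.op (Opposite.op n))))
        ((extEquiv j (ModuleCat.of R M) (ModuleCat.of R (R ⧸ a ^ n))).symm x)
      exact h.trans (congrArg (LocCoh.of a M j n) (LinearEquiv.apply_symm_apply _ _)))
    (by
      refine congrArg ModuleCat.Hom.hom ((localCohomologyIsColimit a M j).hom_ext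
        (f := (localCohomologyIsColimit a M j).desc (locCohCocone a M j) ≫ ModuleCat.ofHom
          (Module.DirectLimit.lift R ℕ _ _ (toLocalCohomology a M j)
            (toLocalCohomology_extTrans a M j))) (f' := 𝟙 _) fun n => ?_)
      refine (Category.assoc _ _ _).symm.trans ((congrArg (· ≫ ModuleCat.ofHom _)
        ((localCohomologyIsColimit a M j).fac (locCohCocone a M j) n)).trans ?_)
      ext x
      refine (Module.DirectLimit.lift_of (toLocalCohomology a M j)
        (toLocalCohomology_extTrans a M j) _).trans ?_
      exact congrArg _ (LinearEquiv.symm_apply_apply _ _))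

end LocalCohomologyLimit

section TorsionInjective

variable {R : Type u} [CommRing R] (a : Ideal R)
  {M : Type u} [AddCommGroup M] [Module R M]

variable (M) in
/-- The `a`-power torsion submodule. -/
def powTorsion : Submodule R M where
  carrier := {x | ∃ n : ℕ, ∀ r ∈ a ^ n, r • x = 0}
  zero_mem' := ⟨0, fun _ _ => smul_zero _⟩
  add_mem' := by
    rintro x y ⟨n, hn⟩ ⟨m, hm⟩
    refine ⟨max n m, fun r hr => ?_⟩
    rw [smul_add, hn r (Ideal.pow_le_pow_right (le_max_left _ _) hr),
      hm r (Ideal.pow_le_pow_right (le_max_right _ _) hr), add_zero]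
  smul_mem' := by
    rintro c x ⟨n, hn⟩
    exact ⟨n, fun r hr => by rw [smul_comm, hn r hr, smul_zero]⟩

variable (M) in
/-- Every element is killed by a power of `a`. -/
def IsPowTorsion : Prop := ∀ x : M, ∃ n : ℕ, ∀ r ∈ a ^ n, r • x = 0

lemma isPowTorsion_powTorsion : IsPowTorsion a (powTorsion a M) := fun x =>
  let ⟨n, hn⟩ := x.2
  ⟨n, fun r hr => Subtype.ext (hn r hr)⟩

variable {a}

lemma IsPowTorsion.of_surjective {N : Type u} [AddCommGroup N] [Module R N]
    (h : IsPowTorsion a M) {f : M →ₗ[R] N} (hf : Function.Surjective f) : IsPowTorsion a N := by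
  intro y
  obtain ⟨x, rfl⟩ := hf y
  obtain ⟨n, hn⟩ := h x
  exact ⟨n, fun r hr => by rw [← map_smul, hn r hr, map_zero]⟩

lemma IsPowTorsion.support_subset (h : IsPowTorsion a M) :
    Module.support R M ⊆ PrimeSpectrum.zeroLocus (a : Set R) := fun _ hp =>
  le_of_mem_support_of_nilpotent
    (fun t _ hx => let ⟨n, hn⟩ := h t; ⟨n, hn _ (Ideal.pow_mem_pow hx n)⟩) hp

variable [IsNoetherianRing R]

lemma baer_powTorsion (hM : Module.Injective R M) : Module.Baer R (powTorsion a M) := by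
  intro b g
  obtain ⟨n, hn⟩ : ∃ n : ℕ, ∀ r ∈ a ^ n, ∀ x : b, r • g x = 0 := by
    obtain ⟨s, hs⟩ := (isNoetherianRing_iff_ideal_fg R).1 inferInstance b
    have hsb : ∀ x ∈ s, x ∈ b := fun x hx => hs ▸ Submodule.subset_span hx
    choose k hk using fun x : b => isPowTorsion_powTorsion a (g x)
    refine ⟨s.attach.sup fun x => k ⟨x, hsb x x.2⟩, fun r hr => ?_⟩
    have hb : b ≤ Submodule.map b.subtype (LinearMap.ker (r • g)) := by
      conv_lhs => rw [← hs]
      refine Submodule.span_le.2 fun x hx => ⟨⟨x, hsb x hx⟩, ?_, rfl⟩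
      exact hk ⟨x, hsb x hx⟩ r (Ideal.pow_le_pow_right
        (Finset.le_sup (f := fun x : s => k ⟨x, hsb x x.2⟩) (Finset.mem_attach s ⟨x, hx⟩)) hr)
    intro x
    obtain ⟨y, hy, hyx⟩ := hb x.2
    rw [← Subtype.ext (hyx : (y : R) = x)]
    exact hy
  obtain ⟨k, hk⟩ := Ideal.exists_pow_inf_eq_pow_smul (M := R) a b
  let φ : b →ₗ[R] (R ⧸ a ^ (n + k)) := Submodule.mkQ _ ∘ₗ b.subtype
  have hφ : LinearMap.ker φ ≤ LinearMap.ker ((powTorsion a M).subtype ∘ₗ g) := by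
    intro x hx
    have hx' : (x : R) ∈ a ^ (n + k) := (Submodule.Quotient.mk_eq_zero _).1 hx
    have hmem : (x : R) ∈ a ^ (n + k) • (⊤ : Submodule R R) ⊓ b := by
      refine ⟨?_, x.2⟩
      simpa using hx'
    rw [hk _ (Nat.le_add_left _ _), Nat.add_sub_cancel] at hmem
    have hle : a ^ n • (a ^ k • (⊤ : Submodule R R) ⊓ b) ≤
        Submodule.map b.subtype (LinearMap.ker g) := by
      refine Submodule.smul_le.2 fun r hr y hy => ?_
      exact ⟨r • ⟨y, hy.2⟩, by
        rw [SetLike.mem_coe, LinearMap.mem_ker, map_smul]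
        exact hn r hr _, rfl⟩
    obtain ⟨y, hy, hyx⟩ := hle hmem
    have := Subtype.ext (hyx : (y : R) = x)
    subst this
    exact congrArg Subtype.val hy
  obtain ⟨h, hh⟩ := hM.out ((LinearMap.ker φ).liftQ φ le_rfl)
    (LinearMap.ker_eq_bot.1 (Submodule.ker_liftQ_eq_bot _ _ _ le_rfl))
    ((LinearMap.ker φ).liftQ _ hφ)
  refine ⟨LinearMap.codRestrict _ (h ∘ₗ Submodule.mkQ _) fun x => ⟨n + k, fun r hr => ?_⟩, ?_⟩
  · rw [← map_smul, LinearMap.comp_apply, Submodule.mkQ_apply,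
      (Submodule.Quotient.mk_eq_zero _).2 (show r • x ∈ _ from Ideal.mul_mem_right x _ hr),
      map_zero]
  · intro x hx
    exact Subtype.ext (hh (Submodule.Quotient.mk ⟨x, hx⟩))

/-- A power torsion module embeds in a power torsion injective module. -/
lemma IsPowTorsion.exists_injective (hM : IsPowTorsion a M) :
    ∃ (J : Type u) (_ : AddCommGroup J) (_ : Module R J) (f : M →ₗ[R] J),
      Function.Injective f ∧ Injective (ModuleCat.of R J) ∧ IsPowTorsion a J := by
  let I := Injective.under (ModuleCat.of R M)
  have hI : Module.Injective R I :=
    have : Injective (ModuleCat.of R I) := inferInstanceAs (Injective I)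
    Module.injective_module_of_injective_object R I
  have hJ : Module.Injective R (powTorsion a I) := (baer_powTorsion hI).injective
  refine ⟨powTorsion a I, inferInstance, inferInstance,
    LinearMap.codRestrict _ (Injective.ι (ModuleCat.of R M)).hom fun x => ?_, ?_,
    Module.injective_object_of_injective_module _ _, isPowTorsion_powTorsion a⟩
  · obtain ⟨n, hn⟩ := hM x
    exact ⟨n, fun r hr => by rw [← map_smul, hn r hr, map_zero]⟩
  · intro x y hxy
    exact (ModuleCat.mono_iff_injective (Injective.ι (ModuleCat.of R M))).1 inferInstance
      (congrArg Subtype.val hxy)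

end TorsionInjective

section TorsionVanishing

variable {R : Type u} [CommRing R] {a : Ideal R}
  {N N' : Type u} [AddCommGroup N] [Module R N] [AddCommGroup N'] [Module R N']
  {A B C : Type u} [AddCommGroup A] [Module R A] [AddCommGroup B] [Module R B]
  [AddCommGroup C] [Module R C]

/-- Degree zero Ext classes are linear maps. -/
noncomputable def ExtM.ofHom (f : N →ₗ[R] A) : ExtM R N A 0 :=
  Abelian.Ext.mk₀ (ModuleCat.ofHom f)

lemma ExtM.exists_ofHom (x : ExtM R N A 0) : ∃ f : N →ₗ[R] A, ExtM.ofHom f = x := by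
  obtain ⟨f, hf⟩ := (Abelian.Ext.mk₀_bijective _ _).2 x
  exact ⟨f.hom, hf⟩

lemma ExtM.pre_ofHom (g : N' →ₗ[R] N) (f : N →ₗ[R] A) :
    ExtM.pre A 0 g (ExtM.ofHom f) = ExtM.ofHom (f ∘ₗ g) := by
  simp [ExtM.pre_apply, ExtM.ofHom]

lemma ExtM.post_ofHom (g : A →ₗ[R] B) (f : N →ₗ[R] A) :
    ExtM.post N 0 g (ExtM.ofHom f) = ExtM.ofHom (g ∘ₗ f) := by
  simp [ExtM.post_apply, ExtM.ofHom]

variable (a) in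
lemma exists_liftQ_pow {n : ℕ} {x : A} (h : ∀ r ∈ a ^ n, r • x = 0) :
    ∃ f : (R ⧸ a ^ n) →ₗ[R] A, f 1 = x :=
  ⟨Submodule.liftQ _ (LinearMap.toSpanSingleton R A x) fun r hr => h r hr, one_smul R x⟩

lemma quotient_hom_ext {b : Ideal R} {f g : (R ⧸ b) →ₗ[R] A} (h : f 1 = g 1) : f = g := by
  ext
  exact h

lemma extTrans_delta {f : A →ₗ[R] B} {g : B →ₗ[R] C} (hf : Function.Injective f)
    (hfg : Function.Exact f g) (hg : Function.Surjective g) (j n m : ℕ) (h : n ≤ m)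
    (x : ExtM R (R ⧸ a ^ n) C j) :
    extTrans a A (j + 1) n m h (ExtM.delta _ hf hfg hg j x) =
      ExtM.delta _ hf hfg hg j (extTrans a C j n m h x) :=
  ExtM.pre_delta _ hf hfg hg j _ x

lemma extTrans_post (f : A →ₗ[R] B) (j n m : ℕ) (h : n ≤ m)
    (x : ExtM R (R ⧸ a ^ n) A j) :
    extTrans a B j n m h (ExtM.post _ j f x) = ExtM.post _ j f (extTrans a A j n m h x) :=
  ExtM.pre_post _ _ _ _ x

lemma IsPowTorsion.exists_extTrans_eq_zero [IsNoetherianRing R] (hA : IsPowTorsion a A)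
    (j n : ℕ) (x : ExtM R (R ⧸ a ^ n) A (j + 1)) :
    ∃ (m : ℕ) (h : n ≤ m), extTrans a A (j + 1) n m h x = 0 := by
  induction j generalizing A with
  | zero =>
    obtain ⟨J, _, _, f, hf, hJ, hJt⟩ := hA.exists_injective
    have hfg : Function.Exact f (Submodule.mkQ (LinearMap.range f)) := fun y => by simp
    have hg := Submodule.mkQ_surjective (LinearMap.range f)
    obtain ⟨y, rfl⟩ := (ExtM.exact_delta_post _ hf hfg hg 0 x).1
      (Abelian.Ext.eq_zero_of_injective _)
    obtain ⟨c, rfl⟩ := ExtM.exists_ofHom y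
    obtain ⟨t, ht⟩ := hg (c 1)
    obtain ⟨k, hk⟩ := hJt t
    refine ⟨max n k, le_max_left _ _, ?_⟩
    obtain ⟨d, hd⟩ := exists_liftQ_pow a (n := max n k) (x := t)
      fun r hr => hk r (Ideal.pow_le_pow_right (le_max_right _ _) hr)
    rw [extTrans_delta, extTrans, ExtM.pre_ofHom]
    refine (ExtM.exact_post_delta _ hf hfg hg 0 _).2 ⟨ExtM.ofHom d, ?_⟩
    rw [ExtM.post_ofHom]
    congr 1
    refine quotient_hom_ext ?_
    rw [LinearMap.comp_apply, hd, ht]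
    rfl
  | succ j ih =>
    obtain ⟨J, _, _, f, hf, hJ, hJt⟩ := hA.exists_injective
    have hfg : Function.Exact f (Submodule.mkQ (LinearMap.range f)) := fun y => by simp
    have hg := Submodule.mkQ_surjective (LinearMap.range f)
    obtain ⟨y, rfl⟩ := (ExtM.exact_delta_post _ hf hfg hg (j + 1) x).1
      (Abelian.Ext.eq_zero_of_injective _)
    obtain ⟨m, h, hm⟩ := ih (hJt.of_surjective hg) y
    exact ⟨m, h, by rw [extTrans_delta, hm, map_zero]⟩

end TorsionVanishing

section LimitFunctoriality

variable {R : Type u} [CommRing R] (a : Ideal R)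
  {M : Type u} [AddCommGroup M] [Module R M]
  {A B C : Type u} [AddCommGroup A] [Module R A] [AddCommGroup B] [Module R B]
  [AddCommGroup C] [Module R C]

lemma LocCoh.exists_of {j : ℕ} (z : LocCoh a M j) : ∃ n x, LocCoh.of a M j n x = z :=
  Module.DirectLimit.exists_of z

variable {a} in
lemma LocCoh.exists_of_eq_zero {j n : ℕ} {x : ExtM R (R ⧸ a ^ n) M j}
    (h : LocCoh.of a M j n x = 0) : ∃ (m : ℕ) (h : n ≤ m), extTrans a M j n m h x = 0 :=
  Module.DirectLimit.of.zero_exact h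

lemma isPowTorsion_locCoh (j : ℕ) : IsPowTorsion a (LocCoh a M j) := by
  intro z
  obtain ⟨n, x, rfl⟩ := LocCoh.exists_of a z
  refine ⟨n, fun r hr => ?_⟩
  rw [← map_smul, ExtM.smul_eq_zero_of_left _ _ _ _ (fun y => ?_), map_zero]
  obtain ⟨y, rfl⟩ := Ideal.Quotient.mk_surjective y
  exact Ideal.Quotient.eq_zero_iff_mem.2 (Ideal.mul_mem_right y _ hr)

/-- Functoriality of local cohomology. -/
noncomputable def LocCoh.map (j : ℕ) (f : A →ₗ[R] B) : LocCoh a A j →ₗ[R] LocCoh a B j :=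
  Module.DirectLimit.map (fun n => ExtM.post (R ⧸ a ^ n) j f) fun n m h => by
    ext x
    exact (extTrans_post f j n m h x).symm

lemma LocCoh.map_of (j n : ℕ) (f : A →ₗ[R] B) (x : ExtM R (R ⧸ a ^ n) A j) :
    LocCoh.map a j f (LocCoh.of a A j n x) = LocCoh.of a B j n (ExtM.post _ j f x) :=
  Module.DirectLimit.map_apply_of _ _ _

/-- Power torsion kernels do not affect local cohomology in positive degrees. -/
noncomputable def LocCoh.equivOfTorsion [IsNoetherianRing R] {f : A →ₗ[R] B} {g : B →ₗ[R] C}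
    (hf : Function.Injective f)
    (hfg : Function.Exact f g) (hg : Function.Surjective g) (hA : IsPowTorsion a A) (j : ℕ) :
    LocCoh a B (j + 1) ≃ₗ[R] LocCoh a C (j + 1) :=
  LinearEquiv.ofBijective (LocCoh.map a (j + 1) g) (by
    constructor
    · rw [injective_iff_map_eq_zero]
      intro z hz
      obtain ⟨n, x, rfl⟩ := LocCoh.exists_of a z
      rw [LocCoh.map_of] at hz
      obtain ⟨m, h, hm⟩ := LocCoh.exists_of_eq_zero hz
      rw [extTrans_post] at hm
      obtain ⟨y, hy⟩ := (ExtM.exact_post_post _ hf hfg hg (j + 1) _).1 hm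
      obtain ⟨k, h', hk⟩ := hA.exists_extTrans_eq_zero j m y
      rw [← LocCoh.of_extTrans a (j + 1) n m h, ← hy, ← LocCoh.of_extTrans a (j + 1) m k h',
        extTrans_post, hk, map_zero, map_zero]
    · intro z
      obtain ⟨n, x, rfl⟩ := LocCoh.exists_of a z
      obtain ⟨m, h, hm⟩ := hA.exists_extTrans_eq_zero (j + 1) n (ExtM.delta _ hf hfg hg (j + 1) x)
      rw [extTrans_delta] at hm
      obtain ⟨y, hy⟩ := (ExtM.exact_post_delta _ hf hfg hg (j + 1) _).1 hm
      exact ⟨LocCoh.of a B (j + 1) m y, by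
        rw [LocCoh.map_of, hy, LocCoh.of_extTrans]⟩)

/-- Dimension shifting when the middle term has no Ext. -/
noncomputable def LocCoh.shiftEquiv {f : A →ₗ[R] B} {g : B →ₗ[R] C}
    (hf : Function.Injective f)
    (hfg : Function.Exact f g) (hg : Function.Surjective g)
    (hB : ∀ (n i : ℕ) (x : ExtM R (R ⧸ a ^ n) B i), x = 0) (j : ℕ) :
    LocCoh a C j ≃ₗ[R] LocCoh a A (j + 1) :=
  Module.DirectLimit.congr (fun n => LinearEquiv.ofBijective (ExtM.delta (R ⧸ a ^ n) hf hfg hg j)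
    ⟨by
      rw [injective_iff_map_eq_zero]
      intro x hx
      obtain ⟨y, rfl⟩ := (ExtM.exact_post_delta _ hf hfg hg j _).1 hx
      rw [hB n j y, map_zero],
     fun x => (ExtM.exact_delta_post _ hf hfg hg j x).1 (hB n _ _)⟩) fun n m h => by
    ext x
    exact (extTrans_delta hf hfg hg j n m h x).symm

lemma extZeroEquiv_ofHom (f : (R ⧸ a) →ₗ[R] M) : (extZeroEquiv a (ExtM.ofHom f) : M) = f 1 := by
  change (Abelian.Ext.linearEquiv₀ (R := R) (ExtM.ofHom f)).hom 1 = f 1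
  rw [show Abelian.Ext.linearEquiv₀ (R := R) (ExtM.ofHom f) = ModuleCat.ofHom f from
    Abelian.Ext.homEquiv₀.apply_symm_apply (ModuleCat.ofHom f)]
  rfl

lemma torsionBySet_pow_le_powTorsion (n : ℕ) :
    Submodule.torsionBySet R M ((a ^ n : Ideal R) : Set R) ≤ powTorsion a M :=
  fun _ hx => ⟨n, mem_torsionBySet_ideal.1 hx⟩

variable (M) in
/-- Degree zero Ext maps into the power torsion submodule. -/
noncomputable def extZeroToPowTorsion (n : ℕ) : ExtM R (R ⧸ a ^ n) M 0 →ₗ[R] powTorsion a M :=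
  Submodule.inclusion (torsionBySet_pow_le_powTorsion a n) ∘ₗ
    (extZeroEquiv (a ^ n)).toLinearMap

lemma extZeroToPowTorsion_injective (n : ℕ) :
    Function.Injective (extZeroToPowTorsion a M n) :=
  (Submodule.inclusion_injective (torsionBySet_pow_le_powTorsion a n)).comp
    (extZeroEquiv (a ^ n)).injective

lemma extZeroToPowTorsion_ofHom (n : ℕ) (f : (R ⧸ a ^ n) →ₗ[R] M) :
    (extZeroToPowTorsion a M n (ExtM.ofHom f) : M) = f 1 :=
  extZeroEquiv_ofHom _ f

lemma extZeroToPowTorsion_extTrans (n m : ℕ) (h : n ≤ m) (x : ExtM R (R ⧸ a ^ n) M 0) :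
    extZeroToPowTorsion a M m (extTrans a M 0 n m h x) = extZeroToPowTorsion a M n x := by
  obtain ⟨f, rfl⟩ := ExtM.exists_ofHom x
  ext
  rw [extTrans, ExtM.pre_ofHom, extZeroToPowTorsion_ofHom, extZeroToPowTorsion_ofHom]
  rfl

/-- Degree zero local cohomology is the power torsion submodule. -/
noncomputable def LocCoh.zeroEquiv : LocCoh a M 0 ≃ₗ[R] powTorsion a M :=
  LinearEquiv.ofBijective (Module.DirectLimit.lift R ℕ _ _ (extZeroToPowTorsion a M)
    (extZeroToPowTorsion_extTrans a))
    ⟨Module.DirectLimit.lift_injective _ _ (extZeroToPowTorsion_injective a), fun x => by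
      obtain ⟨n, hn⟩ := x.2
      obtain ⟨f, hf⟩ := exists_liftQ_pow a hn
      refine ⟨LocCoh.of a M 0 n (ExtM.ofHom f), ?_⟩
      refine (Module.DirectLimit.lift_of _ (extZeroToPowTorsion_extTrans a) _).trans ?_
      ext
      rw [extZeroToPowTorsion_ofHom, hf]⟩

end LimitFunctoriality

section DimensionShift

variable {R : Type u} [CommRing R] {a : Ideal R}
  {N : Type u} [AddCommGroup N] [Module R N]
  {A B : Type u} [AddCommGroup A] [Module R A] [AddCommGroup B] [Module R B]
  {M : Type u} [AddCommGroup M] [Module R M]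

lemma ExtM.post_sum {ι : Type*} (s : Finset ι) (f : ι → A →ₗ[R] B) (i : ℕ) :
    ExtM.post N i (∑ k ∈ s, f k) = ∑ k ∈ s, ExtM.post N i (f k) := by
  classical
  induction s using Finset.induction_on with
  | empty => exact ExtM.post_zero N i
  | insert k s hk ih => rw [Finset.sum_insert hk, Finset.sum_insert hk, ExtM.post_add, ih]

lemma ExtM.eq_zero_of_isUnit {r : R} (hA : IsUnit (algebraMap R (Module.End R A) r))
    (hN : ∀ y : N, r • y = 0) (i : ℕ) (x : ExtM R N A i) : x = 0 := by
  obtain ⟨v, hv⟩ := hA.exists_left_inv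
  have h : v ∘ₗ (r • LinearMap.id) = (LinearMap.id : A →ₗ[R] A) := hv
  have h' := LinearMap.congr_fun (congrArg (ExtM.post N i) h) x
  rw [ExtM.post_comp, ExtM.post_smul_id, LinearMap.comp_apply, LinearMap.smul_apply,
    LinearMap.id_apply, ExtM.smul_eq_zero_of_left N A i r hN, map_zero, ExtM.post_id] at h'
  exact h'.symm

lemma ExtM.pi_eq_zero {ι : Type u} [Fintype ι] {F : ι → Type u} [∀ k, AddCommGroup (F k)]
    [∀ k, Module R (F k)] {i : ℕ} (h : ∀ (k : ι) (x : ExtM R N (F k) i), x = 0)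
    (x : ExtM R N (∀ k, F k) i) : x = 0 := by
  classical
  have hid : (LinearMap.id : (∀ k, F k) →ₗ[R] _) =
      ∑ k, LinearMap.single R F k ∘ₗ LinearMap.proj k := by
    ext k y j
    simp
  have hx := LinearMap.congr_fun (congrArg (ExtM.post N i) hid) x
  rw [ExtM.post_id, ExtM.post_sum, LinearMap.sum_apply] at hx
  rw [← LinearMap.id_apply (R := R) x, hx]
  refine Finset.sum_eq_zero fun k _ => ?_
  rw [ExtM.post_comp, LinearMap.comp_apply, h k (ExtM.post N i (LinearMap.proj k) x), map_zero]

/-- A module without `a`-power torsion embeds in a module with vanishing Ext. -/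
lemma exists_embedding_ext_eq_zero [IsNoetherianRing R]
    (hM : ∀ (x : M) (n : ℕ), (∀ r ∈ a ^ n, r • x = 0) → x = 0) :
    ∃ (B : Type u) (_ : AddCommGroup B) (_ : Module R B) (f : M →ₗ[R] B),
      Function.Injective f ∧ ∀ (c : Ideal R) (n : ℕ), a ^ n ≤ c →
        ∀ (i : ℕ) (x : ExtM R (R ⧸ c) B i), x = 0 := by
  obtain ⟨s, hs⟩ := (isNoetherianRing_iff_ideal_fg R).1 inferInstance a
  have hsa : ∀ x ∈ s, x ∈ a := fun x hx => hs ▸ Submodule.subset_span hx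
  refine ⟨∀ x : s, LocalizedModule (Submonoid.powers (x : R)) M, inferInstance, inferInstance,
    LinearMap.pi fun x => LocalizedModule.mkLinearMap _ M, ?_, fun c n hc i => ?_⟩
  · rw [injective_iff_map_eq_zero]
    intro m hm
    have hle : a ≤ (Ideal.torsionOf R M m).radical := by
      rw [← hs]
      refine Submodule.span_le.2 fun x hx => ?_
      have h0 : LocalizedModule.mkLinearMap (Submonoid.powers x) M m = 0 := congrFun hm ⟨x, hx⟩
      obtain ⟨⟨_, k, rfl⟩, hk⟩ :=
        (IsLocalizedModule.eq_zero_iff (Submonoid.powers x) _).1 h0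
      exact ⟨k, hk⟩
    obtain ⟨n, hn⟩ := Ideal.exists_pow_le_of_le_radical_of_fg hle
      ((isNoetherianRing_iff_ideal_fg R).1 inferInstance _)
    exact hM m n fun r hr => hn hr
  · refine ExtM.pi_eq_zero fun x => ExtM.eq_zero_of_isUnit (r := (x : R) ^ n) ?_ (fun y => ?_) i
    · exact IsLocalizedModule.map_units (LocalizedModule.mkLinearMap (Submonoid.powers (x : R)) M)
        ⟨(x : R) ^ n, pow_mem (Submonoid.mem_powers _) n⟩
    · obtain ⟨y, rfl⟩ := Ideal.Quotient.mk_surjective y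
      exact Ideal.Quotient.eq_zero_iff_mem.2
        (Ideal.mul_mem_right y _ (hc (Ideal.pow_mem_pow (hsa x x.2) n)))

variable (a) in
lemma eq_zero_of_quotient_powTorsion [IsNoetherianRing R] (x : M ⧸ powTorsion a M) (n : ℕ)
    (h : ∀ r ∈ a ^ n, r • x = 0) : x = 0 := by
  obtain ⟨m, rfl⟩ := Submodule.mkQ_surjective _ x
  have hle : a ≤ (Ideal.torsionOf R M m).radical := by
    intro r hr
    obtain ⟨k, hk⟩ : r ^ n • m ∈ powTorsion a M :=
      (Submodule.Quotient.mk_eq_zero _).1 (h _ (Ideal.pow_mem_pow hr n))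
    refine ⟨k + n, ?_⟩
    change r ^ (k + n) • m = 0
    rw [pow_add, mul_smul]
    exact hk _ (Ideal.pow_mem_pow hr k)
  obtain ⟨k, hk⟩ := Ideal.exists_pow_le_of_le_radical_of_fg hle
    ((isNoetherianRing_iff_ideal_fg R).1 inferInstance _)
  exact (Submodule.Quotient.mk_eq_zero _).2 ⟨k, fun r hr => hk hr⟩

lemma powTorsion_exact :
    Function.Exact (powTorsion a M).subtype (Submodule.mkQ (powTorsion a M)) := fun y => by simp

variable (a M) in
/-- Dimension shifting for local cohomology and for Ext. -/
lemma exists_shift [IsNoetherianRing R] :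
    ∃ (C : Type u) (_ : AddCommGroup C) (_ : Module R C),
      (∀ j, Nonempty (LocCoh a C j ≃ₗ[R] LocCoh a M (j + 1))) ∧
      (∀ i, ExtFin a C i ↔ ExtFin a (M ⧸ powTorsion a M) (i + 1)) ∧
      ExtFin a (M ⧸ powTorsion a M) 0 := by
  obtain ⟨B, _, _, f, hf, hB⟩ :=
    exists_embedding_ext_eq_zero (eq_zero_of_quotient_powTorsion a (M := M))
  have hBfin : ∀ i, ExtFin a B i := fun i => by
    have : Subsingleton (ExtM R (R ⧸ a) B i) :=
      subsingleton_of_forall_eq 0 (hB a 1 (pow_one a).le i)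
    exact (inferInstance : Module.Finite R (ExtM R (R ⧸ a) B i))
  have hfg : Function.Exact f (Submodule.mkQ (LinearMap.range f)) := fun y => by simp
  have hg := Submodule.mkQ_surjective (LinearMap.range f)
  refine ⟨B ⧸ LinearMap.range f, inferInstance, inferInstance, fun j => ⟨?_⟩, fun i => ⟨?_, ?_⟩,
    (hBfin 0).of_injective hf⟩
  · exact (LocCoh.shiftEquiv a hf hfg hg (fun n => hB (a ^ n) n le_rfl) j) ≪≫ₗ
      (LocCoh.equivOfTorsion a (Submodule.injective_subtype _) powTorsion_exact
        (Submodule.mkQ_surjective _) (isPowTorsion_powTorsion a) j).symm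
  · exact fun h => ExtFin.left hf hfg hg h (hBfin _)
  · exact fun h => ExtFin.right hf hfg hg (hBfin _) h

end DimensionShift

section Main

variable {R : Type u} [CommRing R] [IsNoetherianRing R] {a : Ideal R}
  {M : Type u} [AddCommGroup M] [Module R M]

lemma extFin_powTorsion (hdim : ringKrullDim R ≤ 2) (h : ∀ i, ExtFin a M i) (i : ℕ) :
    ExtFin a (powTorsion a M) i := by
  have hinj := Submodule.injective_subtype (powTorsion a M)
  obtain ⟨C, _, _, -, -, h0⟩ := exists_shift a M
  refine extFin_of_torsion_of_dim_le_two hdim a _ (fun t x hx => ?_) ((h 0).of_injective hinj)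
    (ExtFin.left hinj powTorsion_exact (Submodule.mkQ_surjective _) h0 (h 1)) i
  obtain ⟨k, hk⟩ := isPowTorsion_powTorsion a t
  exact ⟨k, hk _ (Ideal.pow_mem_pow hx k)⟩

lemma extFin_locCoh_of_extFin (hdim : ringKrullDim R ≤ 2) (h : ∀ i, ExtFin a M i) (j i : ℕ) :
    ExtFin a (LocCoh a M j) i := by
  induction j generalizing M i with
  | zero => exact (extFin_powTorsion hdim h i).congr (LocCoh.zeroEquiv a).symm
  | succ j ih =>
    obtain ⟨C, _, _, hC, hCfin, -⟩ := exists_shift a M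
    obtain ⟨e⟩ := hC j
    refine ExtFin.congr e (ih (fun i => (hCfin i).2 ?_) i)
    exact ExtFin.right (Submodule.injective_subtype _) powTorsion_exact
      (Submodule.mkQ_surjective _) (h _) (extFin_powTorsion hdim h _)

lemma extFin_of_extFin_locCoh (h : ∀ j i, ExtFin a (LocCoh a M j) i) (i : ℕ) : ExtFin a M i := by
  induction i generalizing M with
  | zero =>
    obtain ⟨C, _, _, -, -, h0⟩ := exists_shift a M
    exact ExtFin.mid (Submodule.injective_subtype _) powTorsion_exact (Submodule.mkQ_surjective _)
      ((h 0 0).congr (LocCoh.zeroEquiv a)) h0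
  | succ i ih =>
    obtain ⟨C, _, _, hC, hCfin, -⟩ := exists_shift a M
    refine ExtFin.mid (Submodule.injective_subtype _) powTorsion_exact
      (Submodule.mkQ_surjective _) ((h 0 (i + 1)).congr (LocCoh.zeroEquiv a)) ((hCfin i).1 ?_)
    refine ih fun j i => ?_
    obtain ⟨e⟩ := hC j
    exact (h (j + 1) i).congr e.symm

end Main

/-- Theorem 3.4, case (c): if `dim R ≤ 2`, then all `H^i_𝔞(M)` are `𝔞`-cofinite iff all
`Ext^i_R(R/𝔞, M)` are finitely generated. -/
theorem localCohomology_isCofinite_iff_ext_finite_of_dim_le_two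
    (R : Type u) [CommRing R] [IsNoetherianRing R] (𝔞 : Ideal R)
    (hdim : ringKrullDim R ≤ 2)
    (M : Type u) [AddCommGroup M] [Module R M] :
    (∀ i : ℕ, IsCofinite R 𝔞 (localCohomologyModule R 𝔞 M i)) ↔
      (∀ i : ℕ, Module.Finite R (extModule R (R ⧸ 𝔞) M i)) := by
  have hext : ∀ (N : Type u) [AddCommGroup N] [Module R N] (i : ℕ),
      Module.Finite R (extModule R (R ⧸ 𝔞) N i) ↔ ExtFin 𝔞 N i := fun N _ _ i =>
    Module.Finite.equiv_iff (extEquiv i (ModuleCat.of R N) (ModuleCat.of R (R ⧸ 𝔞)))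
  have e : ∀ j, localCohomologyModule R 𝔞 M j ≃ₗ[R] LocCoh 𝔞 M j :=
    localCohomologyEquiv 𝔞 M
  constructor
  · intro h i
    rw [hext]
    exact extFin_of_extFin_locCoh (fun j i => ((hext _ i).1 ((h j).2 i)).congr (e j)) i
  · intro h j
    refine ⟨?_, fun i => ?_⟩
    · rw [(e j).support_eq]
      exact (isPowTorsion_locCoh 𝔞 j).support_subset
    · rw [hext]
      exact (extFin_locCoh_of_extFin hdim (fun i => (hext M i).1 (h i)) j i).congr (e j).symm
end

section
/- Let R be a commutative Noetherian ring, N a finitely generated R-module, and M an arbitrary R-module. Let t be a non-negative integer such that Ext^i_R(N, M) is a finitely generated R-module for all 0 ≤ i ≤ t. Then for any finitely generated R-module L with Supp_R(L) ⊆ Supp_R(N), the module Ext^i_R(L, M) is finitely generated for all 0 ≤ i ≤ t. -/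
universe u

open CategoryTheory

open scoped TensorProduct

/-- If two surjections `f`, `g` from the same module satisfy `ker f ≤ ker g`, then the target of `g`
is finite if the target of `f` is. -/
lemma Module.Finite.of_ker_le_ker {R A B C : Type*} [Ring R] [AddCommGroup A] [Module R A]
    [AddCommGroup B] [Module R B] [AddCommGroup C] [Module R C]
    (f : A →ₗ[R] B) (g : A →ₗ[R] C) (hg : Function.Surjective g)
    (hf : Function.Surjective f) (h : f.ker ≤ g.ker) [Module.Finite R B] :
    Module.Finite R C := by
  have : Module.Finite R (A ⧸ f.ker) :=
    .equiv (f.quotKerEquivOfSurjective hf).symm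
  refine .of_surjective (f.ker.liftQ g h) ?_
  rw [← LinearMap.range_eq_top, Submodule.range_liftQ, LinearMap.range_eq_top]
  exact hg

lemma Module.mem_support_quotient_prime_iff {R : Type*} [CommRing R] (p q : PrimeSpectrum R) :
    q ∈ Module.support R (R ⧸ p.asIdeal) ↔ p ≤ q := by
  rw [Module.support_eq_zeroLocus, Ideal.annihilator_quotient, PrimeSpectrum.mem_zeroLocus]
  rfl

lemma LinearMap.exists_ne_zero_of_mem_support {R N : Type*} [CommRing R] [IsNoetherianRing R]
    [AddCommGroup N] [Module R N] [Module.Finite R N] (p : PrimeSpectrum R)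
    (hp : p ∈ Module.support R N) : ∃ f : N →ₗ[R] R ⧸ p.asIdeal, f ≠ 0 := by
  let κ := p.asIdeal.ResidueField
  have : Nontrivial (κ ⊗[R] N) :=
    (Module.mem_support_iff_nontrivial_residueField_tensorProduct p).1 hp
  obtain ⟨x, hx⟩ := exists_ne (0 : κ ⊗[R] N)
  obtain ⟨φ, hφ⟩ : ∃ φ : Module.Dual κ (κ ⊗[R] N), φ x ≠ 0 := by
    by_contra! h
    exact hx ((Module.forall_dual_apply_eq_zero_iff κ x).1 h)
  let ψ : N →ₗ[R] κ := (φ.restrictScalars R) ∘ₗ TensorProduct.mk R κ N 1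
  have hψ : ψ ≠ 0 := by
    intro h
    have : φ = 0 := by
      ext n
      exact LinearMap.congr_fun h n
    exact hφ (by simp [this])
  have : IsLocalizedModule p.asIdeal.primeCompl
      (IsScalarTower.toAlgHom R (R ⧸ p.asIdeal) κ).toLinearMap := by
    rw [isLocalizedModule_iff_isLocalization]
    have : Algebra.algebraMapSubmonoid (R ⧸ p.asIdeal) p.asIdeal.primeCompl =
        nonZeroDivisors (R ⧸ p.asIdeal) := by
      ext y
      obtain ⟨y, rfl⟩ := Ideal.Quotient.mk_surjective y
      rw [mem_nonZeroDivisors_iff_ne_zero, Ne, Ideal.Quotient.eq_zero_iff_mem]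
      refine ⟨?_, fun hy ↦ ⟨y, hy, rfl⟩⟩
      rintro ⟨z, hz, hzy⟩ hy
      refine hz (Ideal.Quotient.eq_zero_iff_mem.1 ?_)
      rw [← Ideal.Quotient.eq_zero_iff_mem.2 hy, ← hzy]
      rfl
    rw [this]
    infer_instance
  have : Module.FinitePresentation R N := Module.finitePresentation_of_finite R N
  obtain ⟨h, s, hs⟩ := Module.FinitePresentation.exists_lift_of_isLocalizedModule
    p.asIdeal.primeCompl (IsScalarTower.toAlgHom R (R ⧸ p.asIdeal) κ).toLinearMap ψ
  refine ⟨h, fun h0 ↦ hψ ?_⟩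
  ext n
  have hsn : s • ψ n = 0 := by
    rw [← LinearMap.smul_apply, ← hs, h0, LinearMap.comp_zero, LinearMap.zero_apply]
  rw [Submonoid.smul_def, Algebra.smul_def, mul_eq_zero,
    Ideal.algebraMap_residueField_eq_zero] at hsn
  exact hsn.resolve_left s.2


/-- A class of finite modules supported in `Supp N` that contains `N` and is closed under quotients
and extensions contains every finite module supported in `Supp N`. -/
theorem ModuleCat.of_support_subset {R : Type u} [CommRing R] [IsNoetherianRing R]
    (D : ObjectProperty (ModuleCat.{u} R))
    (N : Type u) [AddCommGroup N] [Module R N] [Module.Finite R N]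
    (hN : D (.of R N))
    (quotient : ∀ (A B : Type u) [AddCommGroup A] [Module R A] [Module.Finite R A]
      [AddCommGroup B] [Module R B] (f : A →ₗ[R] B), Function.Surjective f →
      Module.support R A ⊆ Module.support R N → D (.of R A) → D (.of R B))
    (extension : ∀ (A B C : Type u) [AddCommGroup A] [Module R A]
      [AddCommGroup B] [Module R B] [AddCommGroup C] [Module R C]
      (f : A →ₗ[R] B) (g : B →ₗ[R] C), Function.Injective f → Function.Surjective g →
      Function.Exact f g → D (.of R A) → D (.of R C) → D (.of R B))
    (L : Type u) [AddCommGroup L] [Module R L] [Module.Finite R L]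
    (hL : Module.support R L ⊆ Module.support R N) : D (.of R L) := by
  have supp (p : PrimeSpectrum R) (hp : p ∈ Module.support R N) :
      Module.support R (R ⧸ p.asIdeal) ⊆ Module.support R N := by
    intro q hq
    exact Module.mem_support_mono ((Module.mem_support_quotient_prime_iff p q).1 hq) hp
  have filtration (S : Set (PrimeSpectrum R)) (hS : S ⊆ Module.support R N)
      (prime : ∀ p ∈ S, D (.of R (R ⧸ p.asIdeal)))
      (L : Type u) [AddCommGroup L] [Module R L] (hfin : Module.Finite R L)
      (hL : Module.support R L ⊆ S) : D (.of R L) := by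
    induction hfin using IsNoetherianRing.induction_on_isQuotientEquivQuotientPrime R with
    | subsingleton L =>
      exact quotient N L 0 (Function.surjective_to_subsingleton _) subset_rfl hN
    | quotient L p e =>
      have hp : p ∈ S := hL (by
        rw [e.support_eq, Module.mem_support_quotient_prime_iff])
      exact quotient _ L e.symm.toLinearMap e.symm.surjective (supp p (hS hp)) (prime p hp)
    | exact A B C f g hf hg hfg hA hC =>
      exact extension A B C f g hf hg hfg
        (hA ((Module.support_subset_of_injective f hf).trans hL))
        (hC ((Module.support_subset_of_surjective g hg).trans hL))
  refine filtration _ subset_rfl (fun p ↦ ?_) L inferInstance hL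
  have : WellFoundedGT (PrimeSpectrum R) :=
    StrictMono.wellFoundedGT (f := PrimeSpectrum.asIdeal) fun _ _ h ↦ h
  induction p using WellFoundedGT.induction with
  | ind p ih =>
    intro hp
    obtain ⟨f, hf⟩ := LinearMap.exists_ne_zero_of_mem_support p hp
    have hI : D (.of R f.range) :=
      quotient N _ f.rangeRestrict f.surjective_rangeRestrict subset_rfl hN
    refine extension f.range (R ⧸ p.asIdeal) ((R ⧸ p.asIdeal) ⧸ f.range) f.range.subtype
      f.range.mkQ f.range.injective_subtype f.range.mkQ_surjective
      (LinearMap.exact_subtype_mkQ _) hI ?_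
    refine filtration (Module.support R N ∩ Set.Ioi p) Set.inter_subset_left
      (fun q hq ↦ ih q hq.2 hq.1) _ inferInstance fun q hq ↦ ?_
    have hpq : p ≤ q := (Module.mem_support_quotient_prime_iff p q).1
      (Module.support_subset_of_surjective _ f.range.mkQ_surjective hq)
    refine ⟨Module.mem_support_mono hpq hp, lt_of_le_of_ne hpq ?_⟩
    rintro rfl
    obtain ⟨n, hn⟩ : ∃ n, f n ≠ 0 := by
      by_contra! h
      exact hf (LinearMap.ext h)
    obtain ⟨r, hr⟩ := Ideal.Quotient.mk_surjective (f n)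
    rw [Module.mem_support_iff_exists_annihilator] at hq
    obtain ⟨m, hm⟩ := hq
    have : r ∈ p.asIdeal := hm (by
      obtain ⟨m, rfl⟩ := f.range.mkQ_surjective m
      obtain ⟨m, rfl⟩ := Ideal.Quotient.mk_surjective m
      rw [Submodule.mem_annihilator_span_singleton, ← map_smul, Submodule.mkQ_apply,
        Submodule.Quotient.mk_eq_zero]
      refine ⟨m • n, ?_⟩
      rw [map_smul, ← hr, ← Ideal.Quotient.mk_eq_mk, ← Ideal.Quotient.mk_eq_mk,
        ← Submodule.Quotient.mk_smul, ← Submodule.Quotient.mk_smul, smul_eq_mul, smul_eq_mul,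
        mul_comm])
    exact hn (by rw [← hr, Ideal.Quotient.eq_zero_iff_mem.2 this])

/-- Over a Noetherian ring, the middle term of an exact sequence is finite if the outer terms
are. -/
lemma Module.Finite.of_exact_of_isNoetherianRing {R A B C : Type*} [Ring R] [IsNoetherianRing R]
    [AddCommGroup A] [Module R A] [AddCommGroup B] [Module R B] [AddCommGroup C] [Module R C]
    {f : A →ₗ[R] B} {g : B →ₗ[R] C} (h : Function.Exact f g)
    [Module.Finite R A] [Module.Finite R C] : Module.Finite R B := by
  refine Module.Finite.of_exact (f := f) (g := g.rangeRestrict) (fun b ↦ ?_)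
    g.surjective_rangeRestrict
  rw [← h b, ← LinearMap.mem_ker, LinearMap.ker_rangeRestrict, LinearMap.mem_ker]

namespace CategoryTheory.ProjectiveResolution

universe w v

section

variable {C : Type*} [Category.{v} C] [Abelian C] [HasExt.{w} C] {X Y : C}
  (P : ProjectiveResolution X)

lemma eq_zero_of_extMk_eq_zero (f : P.complex.X 0 ⟶ Y) (hf : P.complex.d 1 0 ≫ f = 0)
    (h : P.extMk f 1 rfl hf = 0) : f = 0 := by
  rw [← P.extEquivCohomologyClass.apply_eq_iff_eq, extEquivCohomologyClass_extMk,
    extEquivCohomologyClass_zero, CochainComplex.HomComplex.CohomologyClass.mk_eq_zero_iff,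
    CochainComplex.HomComplex.Cocycle.toSingleMk_mem_coboundaries_iff _ _ _ _ _ 1 (by lia)] at h
  obtain ⟨g, hg⟩ := h
  have : g = 0 := (P.cochainComplex.isZero_of_isStrictlyLE 0 1).eq_of_src _ _
  rw [this, Limits.comp_zero] at hg
  rw [← cancel_epi (P.cochainComplexXIso (-(0 : ℕ)) 0 rfl).hom, ← hg, Limits.comp_zero]

variable {R : Type*} [Ring R] [Linear R C]

lemma smul_extMk {n : ℕ} (r : R) (f : P.complex.X n ⟶ Y) (m : ℕ) (hm : n + 1 = m)
    (hf : P.complex.d m n ≫ f = 0) :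
    r • P.extMk f m hm hf = P.extMk (r • f) m hm (by simp [hf]) := by
  rw [Abelian.Ext.smul_eq_comp_mk₀, extMk_comp_mk₀]
  simp

end

section

variable {R : Type*} [CommRing R] {C : Type*} [Category.{v} C] [Abelian C] [Linear R C]
  {X : C} (P : ProjectiveResolution X) (Y : C) (n : ℕ)

/-- The inclusion of the cocycles of the complex of morphisms from a projective resolution. -/
noncomputable def linearYonedaObjCyclesHom :
    (P.complex.linearYonedaObj R Y).cycles n →ₗ[R] (P.complex.X n ⟶ Y) :=
  ((P.complex.linearYonedaObj R Y).iCycles n).hom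

lemma d_comp_linearYonedaObjCyclesHom (z : (P.complex.linearYonedaObj R Y).cycles n) :
    P.complex.d (n + 1) n ≫ P.linearYonedaObjCyclesHom Y n z = 0 :=
  ConcreteCategory.congr_hom ((P.complex.linearYonedaObj R Y).iCycles_d n (n + 1)) z

lemma linearYonedaObjCyclesHom_injective :
    Function.Injective (P.linearYonedaObjCyclesHom (R := R) Y n) :=
  (ModuleCat.mono_iff_injective ((P.complex.linearYonedaObj R Y).iCycles n)).1 inferInstance

lemma exists_linearYonedaObjCyclesHom_eq (f : P.complex.X n ⟶ Y)
    (hf : P.complex.d (n + 1) n ≫ f = 0) :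
    ∃ z, P.linearYonedaObjCyclesHom (R := R) Y n z = f :=
  let K := P.complex.linearYonedaObj R Y
  (ShortComplex.moduleCat_exact_iff _).1
    (ShortComplex.exact_of_f_is_kernel (.mk _ _ (K.iCycles_d n (n + 1)))
      (K.cyclesIsKernel n (n + 1) (by simp))) f hf

lemma homologyπ_eq_zero_iff_of_succ (z : (P.complex.linearYonedaObj R Y).cycles (n + 1)) :
    (P.complex.linearYonedaObj R Y).homologyπ (n + 1) z = 0 ↔
      ∃ g : P.complex.X n ⟶ Y,
        P.complex.d (n + 1) n ≫ g = P.linearYonedaObjCyclesHom Y (n + 1) z := by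
  let K := P.complex.linearYonedaObj R Y
  have key (g : K.X n) : P.linearYonedaObjCyclesHom Y (n + 1) (K.toCycles n (n + 1) g) =
      P.complex.d (n + 1) n ≫ (show P.complex.X n ⟶ Y from g) :=
    ConcreteCategory.congr_hom (K.toCycles_i n (n + 1)) g
  constructor
  · intro h
    obtain ⟨g, rfl⟩ := (ShortComplex.moduleCat_exact_iff _).1
      (ShortComplex.exact_of_g_is_cokernel
        (.mk _ _ (K.toCycles_comp_homologyπ n (n + 1)))
        (K.homologyIsCokernel n (n + 1) (by simp))) z h
    exact ⟨g, (key g).symm⟩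
  · rintro ⟨g, hg⟩
    obtain rfl : K.toCycles n (n + 1) g = z :=
      P.linearYonedaObjCyclesHom_injective Y (n + 1) ((key g).trans hg)
    exact ConcreteCategory.congr_hom (K.toCycles_comp_homologyπ n (n + 1)) g

lemma homologyπ_zero_injective :
    Function.Injective ((P.complex.linearYonedaObj R Y).homologyπ 0) :=
  (ModuleCat.mono_iff_injective _).1
    (have := (P.complex.linearYonedaObj R Y).isIso_homologyπ 0 0 (by simp)
      ((P.complex.linearYonedaObj R Y).shape _ _ (by simp))
    inferInstance)

variable [HasExt.{w} C]

/-- The class in `Ext` of a cocycle of the complex of morphisms from a projective resolution. -/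
noncomputable def cyclesToExt :
    (P.complex.linearYonedaObj R Y).cycles n →ₗ[R] Abelian.Ext X Y n where
  toFun z := P.extMk (P.linearYonedaObjCyclesHom Y n z) (n + 1) rfl
    (P.d_comp_linearYonedaObjCyclesHom Y n z)
  map_add' z w := by
    simp only [add_extMk, map_add]
  map_smul' r z := by
    simp only [smul_extMk, map_smul, RingHom.id_apply]

lemma cyclesToExt_surjective : Function.Surjective (P.cyclesToExt (R := R) Y n) := by
  intro α
  obtain ⟨f, hf, rfl⟩ := P.extMk_surjective α (n + 1) rfl
  obtain ⟨z, rfl⟩ := P.exists_linearYonedaObjCyclesHom_eq (R := R) Y n f hf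
  exact ⟨z, rfl⟩

lemma ker_homologyπ_eq_ker_cyclesToExt :
    ((P.complex.linearYonedaObj R Y).homologyπ n).hom.ker = (P.cyclesToExt (R := R) Y n).ker := by
  ext z
  cases n with
  | zero =>
    refine (map_eq_zero_iff _ (P.homologyπ_zero_injective (R := R) Y)).trans
      ⟨fun h ↦ by rw [h]; exact zero_mem _, fun h ↦ ?_⟩
    exact P.linearYonedaObjCyclesHom_injective Y 0
      ((P.eq_zero_of_extMk_eq_zero _
        (P.d_comp_linearYonedaObjCyclesHom Y 0 z) h).trans (map_zero _).symm)
  | succ n =>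
    exact (P.homologyπ_eq_zero_iff_of_succ Y n z).trans (P.extMk_eq_zero_iff _ _ rfl
      (P.d_comp_linearYonedaObjCyclesHom Y (n + 1) z) n rfl).symm

end

end CategoryTheory.ProjectiveResolution

lemma extModule_finite_iff (R : Type u) [CommRing R] (N M : Type u)
    [AddCommGroup N] [Module R N] [AddCommGroup M] [Module R M] (i : ℕ) :
    Module.Finite R (extModule R N M i) ↔
      Module.Finite R (Abelian.Ext (ModuleCat.of R N) (ModuleCat.of R M) i) := by
  let P := projectiveResolution (ModuleCat.of R N)
  let M' := ModuleCat.of R M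
  let e : extModule R N M i ≃ₗ[R] (P.complex.linearYonedaObj R M').homology i :=
    (P.isoExt i M').toLinearEquiv
  have hπ : Function.Surjective ((P.complex.linearYonedaObj R M').homologyπ i).hom :=
    (ModuleCat.epi_iff_surjective _).1 inferInstance
  have hker := P.ker_homologyπ_eq_ker_cyclesToExt (R := R) M' i
  have hsurj := P.cyclesToExt_surjective (R := R) M' i
  refine (Module.Finite.equiv_iff e).trans ⟨fun _ ↦ ?_, fun _ ↦ ?_⟩
  · exact .of_ker_le_ker _ _ hsurj hπ hker.le
  · exact .of_ker_le_ker _ _ hπ hsurj hker.ge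

lemma CategoryTheory.Abelian.Ext.finite_X₃ {R : Type*} [CommRing R] [IsNoetherianRing R]
    {C : Type*} [Category* C] [Abelian C] [Linear R C] [HasExt C] {S : ShortComplex C}
    (hS : S.ShortExact) (Y : C) (i : ℕ) (h₁ : ∀ j, j + 1 = i → Module.Finite R (Ext S.X₁ Y j))
    (h₂ : Module.Finite R (Ext S.X₂ Y i)) : Module.Finite R (Ext S.X₃ Y i) := by
  cases i with
  | zero =>
    have : Mono S.f := hS.mono_f
    have : Epi S.g := hS.epi_g
    exact .of_injective ((mk₀ S.g).precompOfLinear R Y (zero_add 0))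
      (precomp_mk₀_injective_of_epi Y S.g)
  | succ j =>
    have := h₁ j rfl
    refine .of_exact_of_isNoetherianRing (f := hS.extClass.precompOfLinear R Y (add_comm 1 j))
      (g := (mk₀ S.g).precompOfLinear R Y (zero_add (j + 1))) fun x ↦ ⟨fun hx ↦ ?_, ?_⟩
    · exact contravariant_sequence_exact₃ hS Y x hx (add_comm 1 j)
    · rintro ⟨y, rfl⟩
      exact hS.comp_extClass_assoc y (add_comm 1 j)

lemma CategoryTheory.Abelian.Ext.finite_X₂ {R : Type*} [CommRing R] [IsNoetherianRing R]
    {C : Type*} [Category* C] [Abelian C] [Linear R C] [HasExt C] {S : ShortComplex C}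
    (hS : S.ShortExact) (Y : C) (i : ℕ) (h₁ : Module.Finite R (Ext S.X₁ Y i))
    (h₃ : Module.Finite R (Ext S.X₃ Y i)) : Module.Finite R (Ext S.X₂ Y i) := by
  refine .of_exact_of_isNoetherianRing (f := (mk₀ S.g).precompOfLinear R Y (zero_add i))
    (g := (mk₀ S.f).precompOfLinear R Y (zero_add i)) fun x ↦ ⟨fun hx ↦ ?_, ?_⟩
  · exact contravariant_sequence_exact₂ hS Y x hx
  · rintro ⟨y, rfl⟩
    simp

/-- Lemma 3.7: if `Ext^i_R(N, M)` is finitely generated for `0 ≤ i ≤ t` and `L` is a finitely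
generated module with `Supp L ⊆ Supp N`, then `Ext^i_R(L, M)` is finitely generated for
`0 ≤ i ≤ t`. -/
theorem ext_finite_of_supp_subset_supp
    (R : Type u) [CommRing R] [IsNoetherianRing R]
    (N : Type u) [AddCommGroup N] [Module R N] [Module.Finite R N]
    (M : Type u) [AddCommGroup M] [Module R M]
    (t : ℕ) (hext : ∀ i ≤ t, Module.Finite R (extModule R N M i))
    (L : Type u) [AddCommGroup L] [Module R L] [Module.Finite R L]
    (hL : Module.support R L ⊆ Module.support R N) :
    ∀ i ≤ t, Module.Finite R (extModule R L M i) := by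
  simp only [extModule_finite_iff] at hext ⊢
  intro i hi
  induction i using Nat.strong_induction_on generalizing L with
  | h i ih =>
    refine ModuleCat.of_support_subset
      (fun L ↦ Module.Finite R (Abelian.Ext L (ModuleCat.of R M) i)) N (hext i hi) ?_ ?_ L hL
    · intro A B _ _ _ _ _ f hf hA hfin
      refine Abelian.Ext.finite_X₃ (LinearMap.shortExact_shortComplexKer hf) _ i
        (fun j hj ↦ ih j (by lia) f.ker ?_ (by lia)) hfin
      exact (Module.support_subset_of_injective _ f.ker.injective_subtype).trans hA
    · intro A B C _ _ _ _ _ _ f g hf hg hfg hA hC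
      let S := ShortComplex.mk (ModuleCat.ofHom f) (ModuleCat.ofHom g)
        (ModuleCat.hom_ext hfg.linearMap_comp_eq_zero)
      exact Abelian.Ext.finite_X₂ (ModuleCat.shortComplex_shortExact S hfg hf hg) _ i hA hC
end
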